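/- arXiv:1503.00605 — 2 statements merged into one kernel-verified Lean document; each statement's English description precedes it below -/
import Mathlib

section
/- Let k be a positive integer. If a triangulation of the 2-sphere has exactly two vertices whose degrees are not divisible by k, then these two vertices are not adjacent. -/
/-!
Combinatorial triangulated surfaces.

A triangulation is encoded by its finset of faces (each a 3-element finset of
vertices).  `IsClosedSurface` says: nonempty, every face a triangle, every edge
in exactly two faces, and the faces around each vertex are connected through
edges containing that vertex (so the link of every vertex is a single cycle).
A connected closed surface with Euler characteristic 2 is a sphere, with
Euler characteristic 1 is the projective plane, and an orientable one with
Euler characteristic 0 is the torus.  Surfaces with boundary allow edges lying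
in exactly one face; a connected such surface is simply connected iff it is a
disk (Euler characteristic 1, with boundary) or a sphere (Euler characteristic 2).
The degree of a vertex is the number of edges containing it.
-/

namespace Fisk

variable {V : Type*} [DecidableEq V]

/-- The edges of a triangulation: the 2-element subsets of its faces. -/
def edges (F : Finset (Finset V)) : Finset (Finset V) :=
  F.biUnion (fun f => f.powersetCard 2)

/-- The vertex set of a triangulation. -/
def vertices (F : Finset (Finset V)) : Finset V := F.sup id

/-- The degree of a vertex: the number of edges containing it. -/
def degree (F : Finset (Finset V)) (v : V) : ℕ :=
  ((edges F).filter (fun e => v ∈ e)).card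

/-- Two vertices are adjacent if they span an edge. -/
def IsAdjacent (F : Finset (Finset V)) (a b : V) : Prop :=
  a ≠ b ∧ ({a, b} : Finset V) ∈ edges F

/-- The faces are connected under the relation "share an edge". -/
def FacesConnected (F : Finset (Finset V)) : Prop :=
  ∀ f ∈ F, ∀ g ∈ F,
    Relation.ReflTransGen (fun x y => x ∈ F ∧ y ∈ F ∧ (x ∩ y).card = 2) f g

/-- Around every vertex, the faces containing it are connected through
edges containing it (links are connected). -/
def LinkConnected (F : Finset (Finset V)) : Prop :=
  ∀ v : V, ∀ f ∈ F, ∀ g ∈ F, v ∈ f → v ∈ g →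
    Relation.ReflTransGen
      (fun x y => x ∈ F ∧ y ∈ F ∧ v ∈ x ∧ v ∈ y ∧ (x ∩ y).card = 2) f g

/-- A triangulation of a closed surface. -/
def IsClosedSurface (F : Finset (Finset V)) : Prop :=
  F.Nonempty ∧ (∀ f ∈ F, f.card = 3) ∧
  (∀ e ∈ edges F, (F.filter (fun f => e ⊆ f)).card = 2) ∧
  LinkConnected F

/-- The Euler characteristic `#V - #E + #F`. -/
def eulerChar (F : Finset (Finset V)) : ℤ :=
  ((vertices F).card : ℤ) - ((edges F).card : ℤ) + (F.card : ℤ)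

/-- A triangulation of the 2-sphere: a connected closed surface with
Euler characteristic 2. -/
def IsSphere (F : Finset (Finset V)) : Prop :=
  IsClosedSurface F ∧ FacesConnected F ∧ eulerChar F = 2

/-- The oriented edges of an ordered triple. -/
def orientedEdges (t : V × V × V) : Finset (V × V) :=
  {(t.1, t.2.1), (t.2.1, t.2.2), (t.2.2, t.1)}

/-- Orientability: each face can be given a cyclic order of its vertices so
that no directed edge is induced by two different faces (i.e. adjacent faces
induce opposite orientations on their common edge). -/
def Orientable (F : Finset (Finset V)) : Prop :=
  ∃ o : Finset V → V × V × V,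
    (∀ f ∈ F, ({(o f).1, (o f).2.1, (o f).2.2} : Finset V) = f) ∧
    (∀ f ∈ F, ∀ g ∈ F, f ≠ g → ∀ p ∈ orientedEdges (o f), p ∉ orientedEdges (o g))

/-- A triangulation of the torus: a connected orientable closed surface with
Euler characteristic 0. -/
def IsTorus (F : Finset (Finset V)) : Prop :=
  IsClosedSurface F ∧ FacesConnected F ∧ Orientable F ∧ eulerChar F = 0

/-- A triangulation of the projective plane: a connected closed surface with
Euler characteristic 1. -/
def IsProjectivePlane (F : Finset (Finset V)) : Prop :=
  IsClosedSurface F ∧ FacesConnected F ∧ eulerChar F = 1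

/-- A triangulation of a surface, possibly with boundary: every edge lies in
one or two faces. -/
def IsSurfaceWithBoundary (F : Finset (Finset V)) : Prop :=
  F.Nonempty ∧ (∀ f ∈ F, f.card = 3) ∧
  (∀ e ∈ edges F,
    (F.filter (fun f => e ⊆ f)).card = 1 ∨ (F.filter (fun f => e ⊆ f)).card = 2) ∧
  LinkConnected F

/-- The boundary edges: edges lying in exactly one face. -/
def boundaryEdges (F : Finset (Finset V)) : Finset (Finset V) :=
  (edges F).filter (fun e => (F.filter (fun f => e ⊆ f)).card = 1)

/-- The boundary vertices: vertices of boundary edges. -/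
def boundaryVertices (F : Finset (Finset V)) : Finset V :=
  (boundaryEdges F).sup id

/-- A compact connected surface (possibly with boundary) is simply connected
iff it is a sphere (χ = 2) or a disk (χ = 1, nonempty boundary). -/
def IsSimplyConnectedSurface (F : Finset (Finset V)) : Prop :=
  IsSurfaceWithBoundary F ∧ FacesConnected F ∧
    (eulerChar F = 2 ∨ (eulerChar F = 1 ∧ (boundaryEdges F).Nonempty))

/-- A triangulation of a disk (= of a polygon, the corners being the boundary
vertices): a connected surface with nonempty boundary and Euler characteristic 1. -/
def IsDisk (F : Finset (Finset V)) : Prop :=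
  IsSurfaceWithBoundary F ∧ FacesConnected F ∧ eulerChar F = 1 ∧
    (boundaryEdges F).Nonempty

/-- A proper vertex coloring: the two endpoints of every edge get distinct
colors (for a triangulation: every triangle receives all three colors). -/
def ProperColoring {C : Type*} (F : Finset (Finset V)) (c : V → C) : Prop :=
  ∀ e ∈ edges F, ∀ u ∈ e, ∀ w ∈ e, u ≠ w → c u ≠ c w

end Fisk

namespace Fisk

/-- A set of flags of a surface decomposed into polygons, with the involutions changing the
vertex, the edge and the face of a flag. -/
structure FlagSystem (X : Type*) where
  s0 : X → X
  s1 : X → X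
  s2 : X → X
  inv0 : Function.Involutive s0
  inv1 : Function.Involutive s1
  inv2 : Function.Involutive s2
  comm : ∀ x, s0 (s2 x) = s2 (s0 x)
  ne0 : ∀ x, s0 x ≠ x
  ne1 : ∀ x, s1 x ≠ x
  ne2 : ∀ x, s2 x ≠ x
  ne02 : ∀ x, s0 (s2 x) ≠ x

namespace FlagSystem

variable {X : Type*} (S : FlagSystem X)

/-- The vertices of a flag system: the orbits of `s1` and `s2`. -/
def Vert : Type _ := Quot fun x y => y = S.s1 x ∨ y = S.s2 x

/-- The edges of a flag system: the orbits of `s0` and `s2`. -/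
def Edge : Type _ := Quot fun x y => y = S.s0 x ∨ y = S.s2 x

/-- The faces of a flag system: the orbits of `s0` and `s1`. -/
def Face : Type _ := Quot fun x y => y = S.s0 x ∨ y = S.s1 x

/-- The connected components of a flag system. -/
def Comp : Type _ := Quot fun x y => y = S.s0 x ∨ y = S.s1 x ∨ y = S.s2 x

/-- The vertex of a flag. -/
def vert (x : X) : S.Vert := Quot.mk _ x

/-- The edge of a flag. -/
def edge (x : X) : S.Edge := Quot.mk _ x

/-- The face of a flag. -/
def face (x : X) : S.Face := Quot.mk _ x

/-- The component of a flag. -/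
def comp (x : X) : S.Comp := Quot.mk _ x

theorem vert_s1 (x : X) : S.vert (S.s1 x) = S.vert x := Eq.symm <| Quot.sound (Or.inl rfl)
theorem vert_s2 (x : X) : S.vert (S.s2 x) = S.vert x := Eq.symm <| Quot.sound (Or.inr rfl)
theorem edge_s0 (x : X) : S.edge (S.s0 x) = S.edge x := Eq.symm <| Quot.sound (Or.inl rfl)
theorem edge_s2 (x : X) : S.edge (S.s2 x) = S.edge x := Eq.symm <| Quot.sound (Or.inr rfl)
theorem face_s0 (x : X) : S.face (S.s0 x) = S.face x := Eq.symm <| Quot.sound (Or.inl rfl)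
theorem face_s1 (x : X) : S.face (S.s1 x) = S.face x := Eq.symm <| Quot.sound (Or.inr rfl)
theorem comp_s0 (x : X) : S.comp (S.s0 x) = S.comp x := Eq.symm <| Quot.sound (Or.inl rfl)
theorem comp_s1 (x : X) : S.comp (S.s1 x) = S.comp x :=
  Eq.symm <| Quot.sound (Or.inr (Or.inl rfl))
theorem comp_s2 (x : X) : S.comp (S.s2 x) = S.comp x :=
  Eq.symm <| Quot.sound (Or.inr (Or.inr rfl))

theorem vert_surjective : Function.Surjective S.vert := Quot.mk_surjective
theorem edge_surjective : Function.Surjective S.edge := Quot.mk_surjective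
theorem face_surjective : Function.Surjective S.face := Quot.mk_surjective
theorem comp_surjective : Function.Surjective S.comp := Quot.mk_surjective

instance [Finite X] : Finite S.Vert := Finite.of_surjective _ S.vert_surjective
instance [Finite X] : Finite S.Edge := Finite.of_surjective _ S.edge_surjective
instance [Finite X] : Finite S.Face := Finite.of_surjective _ S.face_surjective
instance [Finite X] : Finite S.Comp := Finite.of_surjective _ S.comp_surjective

/-- The map from vertices to components. -/
def vertComp : S.Vert → S.Comp := Quot.lift S.comp <| by
  rintro x _ (rfl | rfl)
  exacts [(S.comp_s1 x).symm, (S.comp_s2 x).symm]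

/-- The map from faces to components. -/
def faceComp : S.Face → S.Comp := Quot.lift S.comp <| by
  rintro x _ (rfl | rfl)
  exacts [(S.comp_s0 x).symm, (S.comp_s1 x).symm]

theorem vertComp_vert (x : X) : S.vertComp (S.vert x) = S.comp x := rfl

/-- A chosen flag of an edge. -/
noncomputable def rep (e : S.Edge) : X := Quot.out e

theorem edge_rep (e : S.Edge) : S.edge (S.rep e) = e := Quot.out_eq e

theorem edge_eq_iff (x y : X) : S.edge y = S.edge x ↔
    y = x ∨ y = S.s0 x ∨ y = S.s2 x ∨ y = S.s0 (S.s2 x) := by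
  constructor
  · intro h
    have h' := Quot.eqvGen_exact h
    clear h
    induction h' with
    | rel u w h =>
      rcases h with rfl | rfl
      · simp [S.inv0 u]
      · simp [S.inv2 u]
    | refl u => simp
    | symm u w _ ih =>
      rcases ih with rfl | rfl | rfl | rfl
      · simp
      · simp [S.inv0 w]
      · simp [S.inv2 w]
      · simp [S.comm, S.inv0 w, S.inv2 (S.s0 w)]
    | trans u w z _ _ ih1 ih2 =>
      rcases ih1 with rfl | rfl | rfl | rfl <;> rcases ih2 with rfl | rfl | rfl | rfl <;>
        simp [S.comm, S.inv0 _, S.inv2 _]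
  · rintro (rfl | rfl | rfl | rfl) <;> simp [edge_s0, edge_s2]

theorem sum_eq_sum_edge [Fintype X] [Fintype S.Edge] {M : Type*} [AddCommMonoid M] (h : X → M) :
    ∑ x, h x = ∑ e : S.Edge, (h (S.rep e) + h (S.s0 (S.rep e)) + h (S.s2 (S.rep e)) +
      h (S.s0 (S.s2 (S.rep e)))) := by
  classical
  rw [← Finset.sum_fiberwise (s := Finset.univ) (g := S.edge)]
  refine Finset.sum_congr rfl fun e _ => ?_
  set x := S.rep e with hx
  have : (Finset.univ.filter fun y => S.edge y = e) =
      {x, S.s0 x, S.s2 x, S.s0 (S.s2 x)} := by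
    ext y
    rw [← S.edge_rep e, ← hx]
    simp [edge_eq_iff]
  have h1 := S.ne0 x
  have h2 := S.ne2 x
  have h3 := S.ne02 x
  have h4 := S.ne0 (S.s2 x)
  have h5 : S.s0 x ≠ S.s2 x := fun h => h3 (by rw [← h, S.inv0])
  have h6 : S.s0 x ≠ S.s0 (S.s2 x) := fun h => h2 (S.inv0.injective h).symm
  rw [this, Finset.sum_insert, Finset.sum_insert, Finset.sum_insert, Finset.sum_singleton]
  · abel
  · simpa using h4.symm
  · simp [h5, h6]
  · simp [h1.symm, h2.symm, h3.symm]

theorem card_eq_four_mul_card_edge [Fintype X] [Fintype S.Edge] :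
    Fintype.card X = 4 * Fintype.card S.Edge := by
  have := S.sum_eq_sum_edge (fun _ => 1)
  simpa [mul_comm] using this

section Homology

/-- The coboundary of a `0`-cochain modulo `2`. -/
noncomputable def coboundary : (S.Vert → ZMod 2) →ₗ[ZMod 2] (S.Edge → ZMod 2) :=
  LinearMap.funLeft _ _ (fun e => S.vert (S.rep e)) +
    LinearMap.funLeft _ _ (fun e => S.vert (S.s0 (S.rep e)))

/-- The boundary of a `2`-chain modulo `2`. -/
noncomputable def boundary : (S.Face → ZMod 2) →ₗ[ZMod 2] (S.Edge → ZMod 2) :=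
  LinearMap.funLeft _ _ (fun e => S.face (S.rep e)) +
    LinearMap.funLeft _ _ (fun e => S.face (S.s2 (S.rep e)))

theorem zmod_two_eq {a b : ZMod 2} (h : a + b = 0) : a = b := by
  revert a b; decide

theorem coboundary_dotProduct_boundary [Finite X] [Fintype S.Edge] (f : S.Vert → ZMod 2)
    (g : S.Face → ZMod 2) : S.coboundary f ⬝ᵥ S.boundary g = 0 := by
  have := Fintype.ofFinite X
  calc S.coboundary f ⬝ᵥ S.boundary g = ∑ x, f (S.vert x) * g (S.face x) := by
        rw [S.sum_eq_sum_edge]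
        refine Finset.sum_congr rfl fun e _ => ?_
        simp only [coboundary, boundary, LinearMap.add_apply, LinearMap.funLeft_apply,
          Pi.add_apply, face_s0, vert_s2]
        rw [S.comm, vert_s2]
        ring
    _ = 0 := by
        refine Finset.sum_involution (fun x _ => S.s1 x) ?_ ?_ ?_ ?_
        · intro x _
          rw [vert_s1, face_s1]
          exact CharTwo.add_self_eq_zero _
        · intro x _ _
          exact S.ne1 x
        · simp
        · intro x _
          exact S.inv1 x

theorem ker_coboundary_le : LinearMap.ker S.coboundary ≤
    LinearMap.range (LinearMap.funLeft (ZMod 2) (ZMod 2) S.vertComp) := by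
  intro f hf
  have key : ∀ x, f (S.vert (S.s0 x)) = f (S.vert x) := by
    intro x
    have h := zmod_two_eq (congrFun (LinearMap.mem_ker.1 hf) (S.edge x))
    simp only [LinearMap.funLeft_apply] at h
    rcases (S.edge_eq_iff _ _).1 (S.edge_rep (S.edge x)) with h' | h' | h' | h' <;>
      rw [h'] at h <;> simpa [vert_s2, S.inv0 _, S.comm, eq_comm] using h
  refine ⟨Quot.lift (fun x => f (S.vert x)) ?_, ?_⟩
  · rintro x _ (rfl | rfl | rfl)
    exacts [(key x).symm, by rw [vert_s1], by rw [vert_s2]]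
  · funext v
    obtain ⟨x, rfl⟩ := S.vert_surjective v
    rfl

theorem ker_boundary_le : LinearMap.ker S.boundary ≤
    LinearMap.range (LinearMap.funLeft (ZMod 2) (ZMod 2) S.faceComp) := by
  intro f hf
  have key : ∀ x, f (S.face (S.s2 x)) = f (S.face x) := by
    intro x
    have h := zmod_two_eq (congrFun (LinearMap.mem_ker.1 hf) (S.edge x))
    simp only [LinearMap.funLeft_apply] at h
    rcases (S.edge_eq_iff _ _).1 (S.edge_rep (S.edge x)) with h' | h' | h' | h' <;>
      rw [h'] at h <;> simpa [face_s0, S.inv2 _, ← S.comm, eq_comm] using h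
  refine ⟨Quot.lift (fun x => f (S.face x)) ?_, ?_⟩
  · rintro x _ (rfl | rfl | rfl)
    exacts [by rw [face_s0], by rw [face_s1], (key x).symm]
  · funext v
    obtain ⟨x, rfl⟩ := S.face_surjective v
    rfl

/-- Two linear maps with orthogonal ranges have total rank at most the dimension. -/
theorem finrank_range_add_finrank_range_le {K A B E : Type*} [Field K] [Fintype A] [Fintype B]
    [Fintype E] (f : (A → K) →ₗ[K] (E → K)) (g : (B → K) →ₗ[K] (E → K))
    (h : ∀ u v, f u ⬝ᵥ g v = 0) :
    Module.finrank K (LinearMap.range f) + Module.finrank K (LinearMap.range g) ≤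
      Fintype.card E := by
  classical
  have hf : Module.finrank K (LinearMap.range f) =
      Module.finrank K (LinearMap.range (Matrix.toLin' (LinearMap.toMatrix' f).transpose)) := by
    conv_lhs => rw [← Matrix.toLin'_toMatrix' f]
    exact (Matrix.rank_transpose (LinearMap.toMatrix' f)).symm
  have hle : LinearMap.range g ≤
      LinearMap.ker (Matrix.toLin' (LinearMap.toMatrix' f).transpose) := by
    rintro _ ⟨v, rfl⟩
    rw [LinearMap.mem_ker, Matrix.toLin'_apply]
    refine dotProduct_eq_zero _ fun u => ?_
    rw [Matrix.mulVec_transpose, ← Matrix.dotProduct_mulVec, ← Matrix.toLin'_apply,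
      Matrix.toLin'_toMatrix', dotProduct_comm]
    exact h u v
  have h1 := Submodule.finrank_mono hle
  have h2 := LinearMap.finrank_range_add_finrank_ker
    (Matrix.toLin' (LinearMap.toMatrix' f).transpose)
  rw [Module.finrank_fintype_fun_eq_card] at h2
  omega

theorem card_vert_add_card_face_le [Finite X] :
    Nat.card S.Vert + Nat.card S.Face ≤ Nat.card S.Edge + 2 * Nat.card S.Comp := by
  have := Fintype.ofFinite S.Vert
  have := Fintype.ofFinite S.Face
  have := Fintype.ofFinite S.Edge
  have := Fintype.ofFinite S.Comp
  simp only [Nat.card_eq_fintype_card]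
  have h1 := finrank_range_add_finrank_range_le S.coboundary S.boundary
    S.coboundary_dotProduct_boundary
  have h2 := LinearMap.finrank_range_add_finrank_ker S.coboundary
  have h3 := LinearMap.finrank_range_add_finrank_ker S.boundary
  have h4 := (Submodule.finrank_mono S.ker_coboundary_le).trans (LinearMap.finrank_range_le _)
  have h5 := (Submodule.finrank_mono S.ker_boundary_le).trans (LinearMap.finrank_range_le _)
  rw [Module.finrank_fintype_fun_eq_card] at h2 h3 h4 h5
  omega

end Homology

theorem face_eq {x y : X} (hbraid : ∀ x, S.s0 (S.s1 (S.s0 x)) = S.s1 (S.s0 (S.s1 x)))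
    (h : S.face y = S.face x) : y = x ∨ y = S.s0 x ∨ y = S.s1 x ∨ y = S.s0 (S.s1 x) ∨
      y = S.s1 (S.s0 x) ∨ y = S.s0 (S.s1 (S.s0 x)) := by
  have h' := Quot.eqvGen_exact h.symm
  clear h
  have step : ∀ u : X, (u = x ∨ u = S.s0 x ∨ u = S.s1 x ∨ u = S.s0 (S.s1 x) ∨
      u = S.s1 (S.s0 x) ∨ u = S.s0 (S.s1 (S.s0 x))) → ∀ w, (w = S.s0 u ∨ w = S.s1 u) →
      (w = x ∨ w = S.s0 x ∨ w = S.s1 x ∨ w = S.s0 (S.s1 x) ∨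
      w = S.s1 (S.s0 x) ∨ w = S.s0 (S.s1 (S.s0 x))) := by
    have e0 := S.inv0
    have e1 := S.inv1
    rintro u (rfl | rfl | rfl | rfl | rfl | rfl) w (rfl | rfl) <;>
      simp [e0 _, e1 _, hbraid]
  have : ∀ u w, Relation.EqvGen (fun x y => y = S.s0 x ∨ y = S.s1 x) u w →
      ((u = x ∨ u = S.s0 x ∨ u = S.s1 x ∨ u = S.s0 (S.s1 x) ∨
      u = S.s1 (S.s0 x) ∨ u = S.s0 (S.s1 (S.s0 x))) ↔
      (w = x ∨ w = S.s0 x ∨ w = S.s1 x ∨ w = S.s0 (S.s1 x) ∨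
      w = S.s1 (S.s0 x) ∨ w = S.s0 (S.s1 (S.s0 x)))) := by
    intro u w h
    induction h with
    | rel u w h =>
      refine ⟨fun hu => step u hu w h, fun hw => step w hw u ?_⟩
      rcases h with rfl | rfl
      · exact Or.inl (S.inv0 u).symm
      · exact Or.inr (S.inv1 u).symm
    | refl => exact Iff.rfl
    | symm _ _ _ ih => exact ih.symm
    | trans _ _ _ _ _ i1 i2 => exact i1.trans i2
  exact (this _ _ h').1 (Or.inl rfl)

/-- The rotation of flags about their vertices. -/
def rot : Equiv.Perm X := S.inv2.toPerm * S.inv1.toPerm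

theorem rot_apply (x : X) : S.rot x = S.s2 (S.s1 x) := rfl

theorem vert_rot_zpow (n : ℤ) (x : X) : S.vert ((S.rot ^ n) x) = S.vert x := by
  have h1 : ∀ x, S.vert (S.rot x) = S.vert x := fun x => by rw [rot_apply, vert_s2, vert_s1]
  induction n with
  | zero => rfl
  | succ n ih => rw [add_comm, zpow_add, Equiv.Perm.mul_apply, zpow_one, h1, ih]
  | pred n ih =>
    rw [← ih, ← h1, ← Equiv.Perm.mul_apply, ← zpow_one_add]
    congr 3
    ring

theorem s1_rot_zpow (n : ℤ) (x : X) : S.s1 ((S.rot ^ n) x) = (S.rot ^ (-n)) (S.s1 x) := by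
  have hconj : S.inv1.toPerm * S.rot * S.inv1.toPerm⁻¹ = S.rot⁻¹ := by
    rw [eq_inv_iff_mul_eq_one]
    ext x
    simp [rot, S.inv1 _, S.inv2 _, Equiv.Perm.inv_def]
  have h := congrArg (fun σ : Equiv.Perm X => σ ^ n) hconj
  simp only [conj_zpow, inv_zpow'] at h
  rw [← h]
  simp [Equiv.Perm.inv_def, S.inv1 _]

theorem s2_rot_zpow (n : ℤ) (x : X) : S.s2 ((S.rot ^ n) x) = (S.rot ^ (1 - n)) (S.s1 x) := by
  rw [sub_eq_add_neg, zpow_add, Equiv.Perm.mul_apply, ← s1_rot_zpow, zpow_one, rot_apply, S.inv1]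

theorem rot_zpow_s1_ne (n : ℤ) (x : X) : (S.rot ^ n) (S.s1 x) ≠ x := by
  intro h
  obtain ⟨i, rfl | rfl⟩ := Int.even_or_odd' n
  · refine S.ne1 ((S.rot ^ (-i)) x) ?_
    rw [s1_rot_zpow]
    nth_rw 2 [← h]
    rw [← Equiv.Perm.mul_apply, ← zpow_add]
    congr 2
    ring
  · refine S.ne2 ((S.rot ^ (-i)) x) ?_
    rw [s2_rot_zpow]
    nth_rw 2 [← h]
    rw [← Equiv.Perm.mul_apply, ← zpow_add]
    congr 2
    ring

theorem vert_eq_iff (x y : X) : S.vert y = S.vert x ↔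
    (∃ n : ℤ, (S.rot ^ n) x = y) ∨ ∃ n : ℤ, (S.rot ^ n) (S.s1 x) = y := by
  have step1 : ∀ u, ((∃ n : ℤ, (S.rot ^ n) x = u) ∨ ∃ n : ℤ, (S.rot ^ n) (S.s1 x) = u) →
      ((∃ n : ℤ, (S.rot ^ n) x = S.s1 u) ∨ ∃ n : ℤ, (S.rot ^ n) (S.s1 x) = S.s1 u) := by
    rintro _ (⟨n, rfl⟩ | ⟨n, rfl⟩)
    · exact Or.inr ⟨-n, (S.s1_rot_zpow n x).symm⟩
    · exact Or.inl ⟨-n, by rw [s1_rot_zpow, S.inv1]⟩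
  have step2 : ∀ u, ((∃ n : ℤ, (S.rot ^ n) x = u) ∨ ∃ n : ℤ, (S.rot ^ n) (S.s1 x) = u) →
      ((∃ n : ℤ, (S.rot ^ n) x = S.s2 u) ∨ ∃ n : ℤ, (S.rot ^ n) (S.s1 x) = S.s2 u) := by
    rintro _ (⟨n, rfl⟩ | ⟨n, rfl⟩)
    · exact Or.inr ⟨1 - n, (S.s2_rot_zpow n x).symm⟩
    · exact Or.inl ⟨1 - n, by rw [s2_rot_zpow, S.inv1]⟩
  constructor
  · intro h
    have key : ∀ u w, Relation.EqvGen (fun x y => y = S.s1 x ∨ y = S.s2 x) u w →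
        (((∃ n : ℤ, (S.rot ^ n) x = u) ∨ ∃ n : ℤ, (S.rot ^ n) (S.s1 x) = u) ↔
        ((∃ n : ℤ, (S.rot ^ n) x = w) ∨ ∃ n : ℤ, (S.rot ^ n) (S.s1 x) = w)) := by
      intro u w h
      induction h with
      | rel u w h =>
        rcases h with rfl | rfl
        · exact ⟨step1 u, fun h => by simpa only [S.inv1 u] using step1 _ h⟩
        · exact ⟨step2 u, fun h => by simpa only [S.inv2 u] using step2 _ h⟩
      | refl => exact Iff.rfl
      | symm _ _ _ ih => exact ih.symm
      | trans _ _ _ _ _ i1 i2 => exact i1.trans i2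
    exact (key _ _ (Quot.eqvGen_exact h.symm)).1 (Or.inl ⟨0, rfl⟩)
  · rintro (⟨n, rfl⟩ | ⟨n, rfl⟩) <;> simp [vert_rot_zpow, vert_s1]

/-- The degree of the vertex of a flag: the period of the rotation. -/
noncomputable def deg (x : X) : ℕ := Function.minimalPeriod S.rot x

theorem rot_zpow_eq_iff (n : ℤ) (x : X) : (S.rot ^ n) x = x ↔ (S.deg x : ℤ) ∣ n :=
  MulAction.zpow_smul_eq_iff_minimalPeriod_dvd (a := S.rot) (b := x)

theorem ncard_vert_eq [Finite X] (x : X) : {y | S.vert y = S.vert x}.ncard = 2 * S.deg x := by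
  set O := Set.range fun n : ℤ => (S.rot ^ n) x with hO
  have h1 : {y | S.vert y = S.vert x} = O ∪ S.s1 '' O := by
    ext y
    simp only [Set.mem_ofPred_eq, vert_eq_iff, hO, Set.mem_union, Set.mem_range, Set.mem_image,
      exists_exists_eq_and, s1_rot_zpow]
    refine or_congr Iff.rfl ⟨?_, ?_⟩
    · rintro ⟨n, rfl⟩
      exact ⟨-n, by rw [neg_neg]⟩
    · rintro ⟨n, rfl⟩
      exact ⟨-n, rfl⟩
  have h2 : Disjoint O (S.s1 '' O) := by
    rw [Set.disjoint_left]
    rintro _ ⟨n, rfl⟩ ⟨_, ⟨m, rfl⟩, h⟩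
    simp only [s1_rot_zpow] at h
    refine S.rot_zpow_s1_ne (-n + -m) x ?_
    rw [zpow_add, Equiv.Perm.mul_apply, h, ← Equiv.Perm.mul_apply, ← zpow_add]
    simp
  have h3 : O.ncard = S.deg x := by
    have : O = MulAction.orbit (Subgroup.zpowers S.rot) x := by
      ext y
      simp only [hO, Set.mem_range, MulAction.mem_orbit_iff, Subtype.exists,
        Subgroup.mem_zpowers_iff]
      constructor
      · rintro ⟨n, rfl⟩
        exact ⟨_, ⟨n, rfl⟩, rfl⟩
      · rintro ⟨_, ⟨n, rfl⟩, rfl⟩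
        exact ⟨n, rfl⟩
    have := Fintype.ofFinite (MulAction.orbit (Subgroup.zpowers S.rot) x)
    rw [‹O = _›, ← Nat.card_coe_set_eq, Nat.card_eq_fintype_card,
      ← MulAction.minimalPeriod_eq_card]
    rfl
  rw [h1, Set.ncard_union_eq h2 (Set.toFinite _) (Set.toFinite _),
    Set.ncard_image_of_injective _ S.inv1.injective, h3, two_mul]

section Topograph

variable (k : ℕ)

/-- The flag system of values of binary quadratic forms modulo `k` on superbases: a flag is
equipped with three values, which change across an edge according to the parallelogram law
`Q (x + y) + Q (x - y) = 2 * (Q x + Q y)`. -/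
def topograph : FlagSystem (X × (ZMod k × ZMod k × ZMod k)) where
  s0 w := (S.s0 w.1, w.2.2.1, w.2.1, w.2.2.2)
  s1 w := (S.s1 w.1, w.2.1, w.2.2.2, w.2.2.1)
  s2 w := (S.s2 w.1, w.2.1, w.2.2.1, 2 * w.2.1 + 2 * w.2.2.1 - w.2.2.2)
  inv0 w := by simp [S.inv0 w.1]
  inv1 w := by simp [S.inv1 w.1]
  inv2 w := by simp [S.inv2 w.1]
  comm w := by simp [S.comm w.1, add_comm]
  ne0 w h := S.ne0 w.1 (congrArg Prod.fst h)
  ne1 w h := S.ne1 w.1 (congrArg Prod.fst h)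
  ne2 w h := S.ne2 w.1 (congrArg Prod.fst h)
  ne02 w h := S.ne02 w.1 (congrArg Prod.fst h)

theorem topograph_rot_pow (n : ℕ) (x : X) (p q r : ZMod k) :
    ((S.topograph k).rot ^ n) (x, p, q, r) =
      ((S.rot ^ n) x, p, q + n * (r - q) + n * (n - 1) * p,
        q + (n + 1) * (r - q) + (n + 1) * n * p) := by
  induction n with
  | zero => simp
  | succ n ih =>
    rw [pow_succ', Equiv.Perm.mul_apply, ih, pow_succ', Equiv.Perm.mul_apply, rot_apply, rot_apply]
    simp only [topograph, Prod.mk.injEq, true_and]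
    push_cast
    constructor <;> ring

theorem topograph_rot_zpow_of_dvd {n : ℤ} (hn : (k : ℤ) ∣ n) (x : X)
    (l : ZMod k × ZMod k × ZMod k) :
    ((S.topograph k).rot ^ n) (x, l) = ((S.rot ^ n) x, l) := by
  have hk : ∀ y l, ((S.topograph k).rot ^ k) (y, l) = ((S.rot ^ k) y, l) := by
    rintro y ⟨p, q, r⟩
    simp [topograph_rot_pow]
  have hk' : ∀ y l, ((S.topograph k).rot ^ (k : ℤ)) (y, l) = ((S.rot ^ (k : ℤ)) y, l) := by
    simpa using hk
  obtain ⟨m, rfl⟩ := hn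
  rw [zpow_mul, zpow_mul]
  induction m with
  | zero => rfl
  | succ m ih => rw [add_comm, zpow_add, Equiv.Perm.mul_apply, ih, zpow_one, hk', zpow_add,
      Equiv.Perm.mul_apply, zpow_one]
  | pred m ih =>
    refine (((S.topograph k).rot ^ (k : ℤ)).injective ?_)
    rw [hk' (((S.rot ^ (k : ℤ)) ^ (-(m : ℤ) - 1)) x) l, ← Equiv.Perm.mul_apply,
      ← Equiv.Perm.mul_apply, ← zpow_one_add, ← zpow_one_add, add_sub_cancel, ih]

/-- The vertex of the base under a vertex of the topograph. -/
def baseVert : (S.topograph k).Vert → S.Vert := Quot.lift (fun w => S.vert w.1) <| by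
  rintro w _ (rfl | rfl)
  exacts [(S.vert_s1 _).symm, (S.vert_s2 _).symm]

/-- The value of the quadratic form at a vertex of the topograph. -/
def value : (S.topograph k).Vert → ZMod k := Quot.lift (fun w => w.2.1) <| by
  rintro w _ (rfl | rfl) <;> rfl

theorem topograph_rot_zpow_fst (n : ℤ) (w : X × (ZMod k × ZMod k × ZMod k)) :
    (((S.topograph k).rot ^ n) w).1 = (S.rot ^ n) w.1 := by
  induction n with
  | zero => rfl
  | succ n ih =>
    rw [add_comm, zpow_add, Equiv.Perm.mul_apply, zpow_one_add, Equiv.Perm.mul_apply, ← ih]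
    rfl
  | pred n ih =>
    refine S.rot.injective ?_
    rw [← Equiv.Perm.mul_apply, ← zpow_one_add, add_sub_cancel, ← ih]
    conv_rhs => rw [← add_sub_cancel 1 (-(n : ℤ)), zpow_one_add, Equiv.Perm.mul_apply]
    rfl

theorem topograph_vert_injective {x : X} (hx : k ∣ S.deg x) :
    Function.Injective fun l => (S.topograph k).vert (x, l) := by
  intro l l' h
  rcases ((S.topograph k).vert_eq_iff _ _).1 h with ⟨n, hn⟩ | ⟨n, hn⟩
  · have h1 := congrArg Prod.fst hn
    rw [topograph_rot_zpow_fst, rot_zpow_eq_iff] at h1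
    rw [topograph_rot_zpow_of_dvd _ _ ((Int.natCast_dvd_natCast.2 hx).trans h1)] at hn
    exact (congrArg Prod.snd hn).symm
  · have h1 := congrArg Prod.fst hn
    rw [topograph_rot_zpow_fst] at h1
    exact absurd h1 (S.rot_zpow_s1_ne n x)

theorem exists_topograph_comp_eq {x y : X} (h : S.comp x = S.comp y)
    (l : ZMod k × ZMod k × ZMod k) :
    ∃ l', (S.topograph k).comp (y, l') = (S.topograph k).comp (x, l) := by
  suffices H : ∀ u w, Relation.EqvGen (fun x y => y = S.s0 x ∨ y = S.s1 x ∨ y = S.s2 x) u w →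
      ((∃ l', (S.topograph k).comp (u, l') = (S.topograph k).comp (x, l)) ↔
      ∃ l', (S.topograph k).comp (w, l') = (S.topograph k).comp (x, l)) from
    (H _ _ (Quot.eqvGen_exact h)).1 ⟨l, rfl⟩
  have step : ∀ u w, w = S.s0 u ∨ w = S.s1 u ∨ w = S.s2 u →
      (∃ l', (S.topograph k).comp (u, l') = (S.topograph k).comp (x, l)) →
      ∃ l', (S.topograph k).comp (w, l') = (S.topograph k).comp (x, l) := by
    rintro u _ (rfl | rfl | rfl) ⟨l', hl'⟩
    · exact ⟨_, ((S.topograph k).comp_s0 (u, l')).trans hl'⟩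
    · exact ⟨_, ((S.topograph k).comp_s1 (u, l')).trans hl'⟩
    · exact ⟨_, ((S.topograph k).comp_s2 (u, l')).trans hl'⟩
  intro u w h
  induction h with
  | rel u w h =>
    refine ⟨step u w h, step w u ?_⟩
    rcases h with rfl | rfl | rfl
    exacts [Or.inl (S.inv0 u).symm, Or.inr (Or.inl (S.inv1 u).symm),
      Or.inr (Or.inr (S.inv2 u).symm)]
  | refl => exact Iff.rfl
  | symm _ _ _ ih => exact ih.symm
  | trans _ _ _ _ _ i1 i2 => exact i1.trans i2

end Topograph

theorem card_le_six_mul_card_face [Finite X]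
    (hbraid : ∀ x, S.s0 (S.s1 (S.s0 x)) = S.s1 (S.s0 (S.s1 x))) :
    Nat.card X ≤ 6 * Nat.card S.Face := by
  classical
  have := Fintype.ofFinite X
  have := Fintype.ofFinite S.Face
  rw [Nat.card_eq_fintype_card, Nat.card_eq_fintype_card]
  refine Finset.card_le_mul_card_image_of_maps_to (f := S.face) (fun _ _ => Finset.mem_univ _) 6 ?_
  intro b _
  obtain ⟨x, rfl⟩ := S.face_surjective b
  refine (Finset.card_le_card (t := {x, S.s0 x, S.s1 x, S.s0 (S.s1 x), S.s1 (S.s0 x),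
    S.s0 (S.s1 (S.s0 x))}) fun y hy => ?_).trans Finset.card_le_six
  simpa using S.face_eq hbraid (by simpa using hy)

/-- In a connected flag system of Euler characteristic `2`, if `k` divides the degrees of all
vertices except possibly the two ends of an edge, then it divides the degrees of these as well. -/
theorem dvd_deg [Finite X] {k : ℕ} (hk : 0 < k)
    (hbraid : ∀ x, S.s0 (S.s1 (S.s0 x)) = S.s1 (S.s0 (S.s1 x)))
    (hconn : ∀ x y, S.comp x = S.comp y)
    (hface : Nat.card X = 6 * Nat.card S.Face)
    (heuler : Nat.card S.Vert + Nat.card S.Face = Nat.card S.Edge + 2)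
    (x : X) (hx : S.vert x ≠ S.vert (S.s0 x))
    (hdeg : ∀ y, S.vert y ≠ S.vert x → S.vert y ≠ S.vert (S.s0 x) → k ∣ S.deg y) :
    k ∣ S.deg x := by
  classical
  have : NeZero k := ⟨hk.ne'⟩
  have := Fintype.ofFinite X
  set P := S.topograph k with hP
  have := Fintype.ofFinite S.Vert
  have := Fintype.ofFinite S.Edge
  have := Fintype.ofFinite P.Vert
  have := Fintype.ofFinite P.Edge
  have := Fintype.ofFinite P.Comp
  set L := Fintype.card (ZMod k × ZMod k × ZMod k) with hL
  let c : S.Vert → Finset P.Vert := fun w => Finset.univ.filter fun q => S.baseVert k q = w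
  have hc : ∀ w y l, S.vert y = w → P.vert (y, l) ∈ c w := fun w y l h =>
    Finset.mem_filter.2 ⟨Finset.mem_univ _, h⟩
  have hgood : ∀ w, w ≠ S.vert x → w ≠ S.vert (S.s0 x) → L ≤ (c w).card := by
    intro w h1 h2
    obtain ⟨y, rfl⟩ := S.vert_surjective w
    exact Finset.card_le_card_of_injOn (fun l => P.vert (y, l)) (fun l _ => hc _ _ _ rfl)
      (S.topograph_vert_injective k (hdeg y h1 h2)).injOn
  have hsurj : ∀ w, Set.SurjOn P.vertComp (c w) (Finset.univ : Finset P.Comp) := by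
    intro w q _
    obtain ⟨⟨y, l⟩, rfl⟩ := P.comp_surjective q
    obtain ⟨z, rfl⟩ := S.vert_surjective w
    obtain ⟨l', hl'⟩ := S.exists_topograph_comp_eq k (hconn y z) l
    exact ⟨P.vert (z, l'), hc _ _ _ rfl, hl'⟩
  have hcomp : ∀ w, Fintype.card P.Comp ≤ (c w).card := fun w =>
    Finset.card_le_card_of_surjOn _ (hsurj w)
  have hsum : Fintype.card P.Vert = ∑ w, (c w).card :=
    Finset.card_eq_sum_card_fiberwise fun _ _ => Finset.mem_coe.2 (Finset.mem_univ _)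
  have hsum' : L * (Fintype.card S.Vert - 2) + (c (S.vert x)).card + (c (S.vert (S.s0 x))).card ≤
      Fintype.card P.Vert := by
    rw [hsum, ← Finset.sum_erase_add _ _ (Finset.mem_univ (S.vert (S.s0 x))),
      ← Finset.sum_erase_add _ _ (Finset.mem_erase.2 ⟨hx, Finset.mem_univ (S.vert x)⟩)]
    gcongr
    have h := Finset.card_nsmul_le_sum ((Finset.univ.erase (S.vert (S.s0 x))).erase (S.vert x))
      (fun w => (c w).card) L (fun w hw => by
        simp only [Finset.mem_erase] at hw
        exact hgood w hw.1 hw.2.1)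
    rw [Finset.card_erase_of_mem (Finset.mem_erase.2 ⟨hx, Finset.mem_univ _⟩),
      Finset.card_erase_of_mem (Finset.mem_univ _), Finset.card_univ] at h
    rw [mul_comm]
    exact h
  have hineq := P.card_vert_add_card_face_le
  have hPface := P.card_le_six_mul_card_face (by
    intro w
    simp [hP, topograph, hbraid])
  have hPedge := P.card_eq_four_mul_card_edge
  have hSedge := S.card_eq_four_mul_card_edge
  rw [Nat.card_prod, Nat.card_eq_fintype_card, Nat.card_eq_fintype_card, ← hL] at hPface
  rw [Fintype.card_prod, ← hL] at hPedge
  simp only [Nat.card_eq_fintype_card] at hface heuler hineq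
  have hV : 2 ≤ Fintype.card S.Vert := Fintype.one_lt_card_iff.2 ⟨_, _, hx⟩
  have hle : (c (S.vert (S.s0 x))).card ≤ Fintype.card P.Comp := by
    have h1 := hcomp (S.vert x)
    obtain ⟨V, hV'⟩ := Nat.exists_eq_add_of_le hV
    rw [hV', Nat.add_sub_cancel_left] at hsum'
    have h2 : V + Nat.card S.Face = Fintype.card S.Edge := by omega
    rw [hSedge] at hPedge hface hPface
    rw [hface] at hPface
    rw [← h2] at hPedge
    have h3 : Fintype.card P.Edge = L * V + L * Nat.card S.Face := by nlinarith
    have h4 : L * Nat.card S.Face ≤ Nat.card P.Face := by nlinarith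
    omega
  have hinj : Set.InjOn P.vertComp (c (S.vert (S.s0 x))) :=
    Finset.injOn_of_surjOn_of_card_le _ (fun _ _ => Finset.mem_coe.2 (Finset.mem_univ _))
      (hsurj _) (by simpa using hle)
  have hrot := S.topograph_rot_pow k (S.deg x) x 0 0 1
  rw [(by simpa using (S.rot_zpow_eq_iff (S.deg x) x).2 dvd_rfl : (S.rot ^ S.deg x) x = x)] at hrot
  have heq : P.vert (P.s0 (x, 0, 0, 1)) = P.vert (P.s0 ((P.rot ^ S.deg x) (x, 0, 0, 1))) := by
    refine hinj (hc _ _ _ rfl) ?_ ?_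
    · rw [hrot]
      exact hc _ _ _ rfl
    · refine (P.comp_s0 (x, 0, 0, 1)).trans (Eq.trans ?_ (P.comp_s0 _).symm)
      rw [← zpow_natCast, ← vertComp_vert, ← vertComp_vert, vert_rot_zpow]
  rw [hrot] at heq
  have hval : (0 : ZMod k) = 0 + S.deg x * (1 - 0) + S.deg x * (S.deg x - 1) * 0 :=
    congrArg (S.value k) heq
  rw [← ZMod.natCast_eq_zero_iff]
  simpa using hval.symm

end FlagSystem

section Triangulation

variable {V : Type*} [DecidableEq V] {F : Finset (Finset V)}

/-- The flags of a triangulation: ordered triples of vertices spanning a face. -/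
abbrev Flag (F : Finset (Finset V)) : Type _ :=
  {t : V × V × V // ({t.1, t.2.1, t.2.2} : Finset V) ∈ F}

theorem ne_of_card_eq_three {x y z : V} (h : ({x, y, z} : Finset V).card = 3) :
    x ≠ y ∧ x ≠ z ∧ y ≠ z := by
  refine ⟨?_, ?_, ?_⟩ <;> rintro rfl
  · have := (Finset.card_le_two (a := x) (b := z))
    simp at h
    omega
  · have := (Finset.card_le_two (a := x) (b := y))
    rw [Finset.insert_comm] at h
    simp at h
    have := (Finset.card_le_two (a := y) (b := x))
    omega
  · have := (Finset.card_le_two (a := x) (b := y))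
    simp at h
    omega

theorem exists_eq_insert_of_card_eq_three {x y : V} (hxy : x ≠ y) {g : Finset V}
    (hg : g.card = 3) (h : {x, y} ⊆ g) : ∃ z, g = {x, y, z} := by
  have h1 := Finset.card_sdiff_add_card_eq_card h
  rw [hg, Finset.card_pair hxy] at h1
  obtain ⟨z, hz⟩ := Finset.card_eq_one.1 (Nat.add_right_cancel h1 : (g \ {x, y}).card = 1)
  refine ⟨z, ?_⟩
  rw [← Finset.sdiff_union_of_subset h, hz]
  ext; simp; tauto

theorem eq_of_insert_eq {x y z w : V} (hxz : x ≠ z) (hyz : y ≠ z)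
    (h : ({x, y, z} : Finset V) = {x, y, w}) : z = w := by
  have : z ∈ ({x, y, w} : Finset V) := by rw [← h]; simp
  simpa [hxz.symm, hyz.symm] using this

theorem mem_edges {e : Finset V} : e ∈ edges F ↔ ∃ f ∈ F, e ⊆ f ∧ e.card = 2 := by
  simp [edges, Finset.mem_powersetCard]

theorem pair_mem_edges {x y z : V} (hxy : x ≠ y) (h : ({x, y, z} : Finset V) ∈ F) :
    ({x, y} : Finset V) ∈ edges F :=
  mem_edges.2 ⟨_, h, by intro; simp; tauto, Finset.card_pair hxy⟩

theorem mem_vertices_of_flag (t : Flag F) :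
    t.1.1 ∈ vertices F ∧ t.1.2.1 ∈ vertices F ∧ t.1.2.2 ∈ vertices F := by
  refine ⟨?_, ?_, ?_⟩ <;> exact Finset.mem_sup.2 ⟨_, t.2, by simp⟩

namespace IsClosedSurface

variable (hF : IsClosedSurface F)
include hF

theorem flag_ne (t : Flag F) : t.1.1 ≠ t.1.2.1 ∧ t.1.1 ≠ t.1.2.2 ∧ t.1.2.1 ≠ t.1.2.2 :=
  ne_of_card_eq_three (hF.2.1 _ t.2)

theorem exists_opposite (t : Flag F) : ∃ z, z ≠ t.1.2.2 ∧ ({t.1.1, t.1.2.1, z} : Finset V) ∈ F ∧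
    ∀ w, ({t.1.1, t.1.2.1, w} : Finset V) ∈ F → w = t.1.2.2 ∨ w = z := by
  obtain ⟨⟨x, y, z⟩, ht⟩ := t
  obtain ⟨hxy, hxz, hyz⟩ := ne_of_card_eq_three (hF.2.1 _ ht)
  have hcard := hF.2.2.1 _ (pair_mem_edges hxy ht)
  have hsub : ∀ w : V, ({x, y} : Finset V) ⊆ {x, y, w} := by intro w u; simp; tauto
  have hmem : ({x, y, z} : Finset V) ∈ F.filter fun f => {x, y} ⊆ f :=
    Finset.mem_filter.2 ⟨ht, hsub z⟩
  obtain ⟨g, hg, hne⟩ := Finset.exists_mem_ne (s := F.filter fun f => {x, y} ⊆ f)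
    (by rw [hcard]; norm_num) {x, y, z}
  obtain ⟨hgF, hgs⟩ := Finset.mem_filter.1 hg
  obtain ⟨z', rfl⟩ := exists_eq_insert_of_card_eq_three hxy (hF.2.1 _ hgF) hgs
  refine ⟨z', fun h => hne (by rw [h]), hgF, fun w hw => ?_⟩
  have heq : F.filter (fun f => {x, y} ⊆ f) = {{x, y, z}, {x, y, z'}} := by
    refine (Finset.eq_of_subset_of_card_le ?_ ?_).symm
    · intro u hu
      simp only [Finset.mem_insert, Finset.mem_singleton] at hu
      rcases hu with rfl | rfl
      exacts [hmem, hg]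
    · rw [hcard, Finset.card_pair hne.symm]
  have hw' : ({x, y, w} : Finset V) ∈ F.filter fun f => {x, y} ⊆ f :=
    Finset.mem_filter.2 ⟨hw, hsub w⟩
  rw [heq, Finset.mem_insert, Finset.mem_singleton] at hw'
  obtain ⟨-, hxw, hyw⟩ := ne_of_card_eq_three (hF.2.1 _ hw)
  exact hw'.imp (eq_of_insert_eq hxw hyw) (eq_of_insert_eq hxw hyw)

/-- The third vertex of the other face containing the edge of a flag. -/
noncomputable def opposite (t : Flag F) : V := (hF.exists_opposite t).choose

theorem opposite_ne (t : Flag F) : hF.opposite t ≠ t.1.2.2 := (hF.exists_opposite t).choose_spec.1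

theorem opposite_mem (t : Flag F) : ({t.1.1, t.1.2.1, hF.opposite t} : Finset V) ∈ F :=
  (hF.exists_opposite t).choose_spec.2.1

theorem eq_or_eq_opposite (t : Flag F) {w : V} (hw : ({t.1.1, t.1.2.1, w} : Finset V) ∈ F) :
    w = t.1.2.2 ∨ w = hF.opposite t :=
  (hF.exists_opposite t).choose_spec.2.2 w hw

/-- The flag system of a triangulated closed surface. -/
noncomputable def flagSystem : FlagSystem (Flag F) where
  s0 t := ⟨(t.1.2.1, t.1.1, t.1.2.2), by simpa [Finset.insert_comm] using t.2⟩
  s1 t := ⟨(t.1.1, t.1.2.2, t.1.2.1), by simpa [Finset.pair_comm] using t.2⟩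
  s2 t := ⟨(t.1.1, t.1.2.1, hF.opposite t), hF.opposite_mem t⟩
  inv0 _ := rfl
  inv1 _ := rfl
  inv2 t := by
    refine Subtype.ext (Prod.ext rfl (Prod.ext rfl ?_))
    exact ((hF.eq_or_eq_opposite ⟨(t.1.1, t.1.2.1, hF.opposite t), hF.opposite_mem t⟩
      t.2).resolve_left (hF.opposite_ne t).symm).symm
  comm t := by
    refine Subtype.ext (Prod.ext rfl (Prod.ext rfl ?_))
    refine (hF.eq_or_eq_opposite _ ?_).resolve_left (hF.opposite_ne t)
    rw [Finset.insert_comm]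
    exact hF.opposite_mem t
  ne0 t h := (hF.flag_ne t).1 (congrArg (fun t => t.1.1) h).symm
  ne1 t h := (hF.flag_ne t).2.2 (congrArg (fun t => t.1.2.1) h).symm
  ne2 t h := hF.opposite_ne t (congrArg (fun t => t.1.2.2) h)
  ne02 t h := (hF.flag_ne t).1 (congrArg (fun t => t.1.1) h).symm

theorem eq_or_eq_s2 {t u : Flag F} (h1 : u.1.1 = t.1.1) (h2 : u.1.2.1 = t.1.2.1) :
    u = t ∨ u = hF.flagSystem.s2 t := by
  have := u.2
  rw [h1, h2] at this
  exact (hF.eq_or_eq_opposite t this).imp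
    (fun h => Subtype.ext (Prod.ext h1 (Prod.ext h2 h)))
    (fun h => Subtype.ext (Prod.ext h1 (Prod.ext h2 h)))

theorem flagSystem_face_eq_iff {t u : Flag F} : hF.flagSystem.face t = hF.flagSystem.face u ↔
    ({t.1.1, t.1.2.1, t.1.2.2} : Finset V) = {u.1.1, u.1.2.1, u.1.2.2} := by
  constructor
  · intro h
    refine congrArg (Quot.lift (fun t : Flag F => ({t.1.1, t.1.2.1, t.1.2.2} : Finset V)) ?_) h
    rintro t _ (rfl | rfl)
    · exact Finset.insert_comm _ _ _
    · exact congrArg _ (Finset.pair_comm _ _)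
  · intro h
    obtain ⟨h1, h2, h3⟩ := hF.flag_ne t
    obtain ⟨⟨x, y, z⟩, ht⟩ := t
    obtain ⟨⟨x', y', z'⟩, hu⟩ := u
    simp only at h h1 h2 h3
    have hx : x ∈ ({x', y', z'} : Finset V) := by rw [← h]; simp
    have hy : y ∈ ({x', y', z'} : Finset V) := by rw [← h]; simp
    have hz : z ∈ ({x', y', z'} : Finset V) := by rw [← h]; simp
    simp only [Finset.mem_insert, Finset.mem_singleton] at hx hy hz
    have e0 := hF.flagSystem.face_s0
    have e1 := hF.flagSystem.face_s1
    rcases hx with rfl | rfl | rfl <;> rcases hy with rfl | rfl | rfl <;>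
      first | exact absurd rfl h1 | rcases hz with rfl | rfl | rfl <;>
      first | exact absurd rfl h2 | exact absurd rfl h3 | skip
    · rfl
    · exact (e1 _).symm
    · exact (e0 _).symm
    · exact ((e0 _).trans (e1 _)).symm
    · exact ((e1 _).trans (e0 _)).symm
    · exact ((e0 _).trans ((e1 _).trans (e0 _))).symm

theorem flagSystem_edge_eq_iff {t u : Flag F} : hF.flagSystem.edge t = hF.flagSystem.edge u ↔
    ({t.1.1, t.1.2.1} : Finset V) = {u.1.1, u.1.2.1} := by
  constructor
  · intro h
    refine congrArg (Quot.lift (fun t : Flag F => ({t.1.1, t.1.2.1} : Finset V)) ?_) h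
    rintro t _ (rfl | rfl)
    · exact Finset.pair_comm _ _
    · rfl
  · intro h
    have key : ∀ t u : Flag F, t.1.1 = u.1.1 → t.1.2.1 = u.1.2.1 →
        hF.flagSystem.edge t = hF.flagSystem.edge u := by
      intro t u h1 h2
      rcases hF.eq_or_eq_s2 h1 h2 with rfl | rfl
      · rfl
      · exact FlagSystem.edge_s2 _ _
    have h1 := hF.flag_ne t
    have hx : t.1.1 ∈ ({u.1.1, u.1.2.1} : Finset V) := by rw [← h]; simp
    have hy : t.1.2.1 ∈ ({u.1.1, u.1.2.1} : Finset V) := by rw [← h]; simp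
    simp only [Finset.mem_insert, Finset.mem_singleton] at hx hy
    rcases hx with hx | hx <;> rcases hy with hy | hy
    · exact absurd (hx.trans hy.symm) h1.1
    · exact key t u hx hy
    · rw [← FlagSystem.edge_s0]
      exact key _ _ hy hx
    · exact absurd (hx.trans hy.symm) h1.1

theorem flagSystem_vert_eq_iff {t u : Flag F} :
    hF.flagSystem.vert t = hF.flagSystem.vert u ↔ t.1.1 = u.1.1 := by
  constructor
  · intro h
    refine congrArg (Quot.lift (fun t : Flag F => t.1.1) ?_) h
    rintro t _ (rfl | rfl) <;> rfl
  · have same : ∀ t u : Flag F, t.1.1 = u.1.1 →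
        ({t.1.1, t.1.2.1, t.1.2.2} : Finset V) = {u.1.1, u.1.2.1, u.1.2.2} →
        hF.flagSystem.vert t = hF.flagSystem.vert u := by
      intro t u h1 h2
      have hne := hF.flag_ne t
      have hy : t.1.2.1 ∈ ({u.1.1, u.1.2.1, u.1.2.2} : Finset V) := by rw [← h2]; simp
      simp only [Finset.mem_insert, Finset.mem_singleton, ← h1, hne.1.symm, false_or] at hy
      rcases hy with hy | hy
      · rcases hF.eq_or_eq_s2 h1 hy with rfl | rfl
        · rfl
        · exact FlagSystem.vert_s2 _ _
      · rcases hF.eq_or_eq_s2 (u := t) (t := hF.flagSystem.s1 u) h1 hy with rfl | rfl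
        · exact FlagSystem.vert_s1 _ _
        · rw [FlagSystem.vert_s2, FlagSystem.vert_s1]
    suffices H : ∀ v : V, ∀ f g : Finset V, Relation.ReflTransGen
        (fun x y => x ∈ F ∧ y ∈ F ∧ v ∈ x ∧ v ∈ y ∧ (x ∩ y).card = 2) f g →
        ∀ t u : Flag F, t.1.1 = v → u.1.1 = v → ({t.1.1, t.1.2.1, t.1.2.2} : Finset V) = f →
        ({u.1.1, u.1.2.1, u.1.2.2} : Finset V) = g →
        hF.flagSystem.vert t = hF.flagSystem.vert u by
      intro h
      exact H t.1.1 _ _ (hF.2.2.2 _ _ t.2 _ u.2 (by simp) (by simp [h])) t u rfl h.symm rfl rfl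
    intro v f g hfg
    induction hfg with
    | refl => exact fun t u h1 h2 h3 h4 => same t u (h1.trans h2.symm) (h3.trans h4.symm)
    | @tail g g' _ hstep ih =>
      intro t u h1 h2 h3 h4
      obtain ⟨hg, hg', hv, hv', hcard⟩ := hstep
      obtain ⟨w, hw⟩ := Finset.card_eq_one.1 (by
        rw [Finset.card_erase_of_mem (Finset.mem_inter.2 ⟨hv, hv'⟩), hcard] :
        ((g ∩ g').erase v).card = 1)
      have hwm : w ∈ (g ∩ g').erase v := by rw [hw]; simp
      obtain ⟨hwv, hwi⟩ := Finset.mem_erase.1 hwm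
      obtain ⟨c, rfl⟩ := exists_eq_insert_of_card_eq_three hwv.symm (hF.2.1 _ hg)
        (Finset.insert_subset hv (Finset.singleton_subset_iff.2 (Finset.mem_inter.1 hwi).1))
      obtain ⟨d, rfl⟩ := exists_eq_insert_of_card_eq_three hwv.symm (hF.2.1 _ hg')
        (Finset.insert_subset hv' (Finset.singleton_subset_iff.2 (Finset.mem_inter.1 hwi).2))
      rw [ih t ⟨(v, w, c), hg⟩ h1 rfl h3 rfl, ← same ⟨(v, w, d), hg'⟩ u h2.symm h4.symm]
      rcases hF.eq_or_eq_s2 (u := ⟨(v, w, c), hg⟩) (t := ⟨(v, w, d), hg'⟩) rfl rfl with h | h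
      · rw [h]
      · rw [h, FlagSystem.vert_s2]

theorem flagSystem_comp_eq (hconn : FacesConnected F) (t u : Flag F) :
    hF.flagSystem.comp t = hF.flagSystem.comp u := by
  have same : ∀ t u : Flag F,
      ({t.1.1, t.1.2.1, t.1.2.2} : Finset V) = {u.1.1, u.1.2.1, u.1.2.2} →
      hF.flagSystem.comp t = hF.flagSystem.comp u := fun t u h =>
    congrArg hF.flagSystem.faceComp (hF.flagSystem_face_eq_iff.2 h)
  suffices H : ∀ f g : Finset V, Relation.ReflTransGen
      (fun x y => x ∈ F ∧ y ∈ F ∧ (x ∩ y).card = 2) f g →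
      ∀ t u : Flag F, ({t.1.1, t.1.2.1, t.1.2.2} : Finset V) = f →
      ({u.1.1, u.1.2.1, u.1.2.2} : Finset V) = g →
      hF.flagSystem.comp t = hF.flagSystem.comp u from
    H _ _ (hconn _ t.2 _ u.2) t u rfl rfl
  intro f g hfg
  induction hfg with
  | refl => exact fun t u h3 h4 => same t u (h3.trans h4.symm)
  | @tail g g' _ hstep ih =>
    intro t u h3 h4
    obtain ⟨hg, hg', hcard⟩ := hstep
    obtain ⟨v, w, hvw, hi⟩ := Finset.card_eq_two.1 hcard
    obtain ⟨c, rfl⟩ := exists_eq_insert_of_card_eq_three hvw (hF.2.1 _ hg)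
      (hi ▸ Finset.inter_subset_left)
    obtain ⟨d, rfl⟩ := exists_eq_insert_of_card_eq_three hvw (hF.2.1 _ hg')
      (hi ▸ Finset.inter_subset_right)
    rw [ih t ⟨(v, w, c), hg⟩ h3 rfl, ← same ⟨(v, w, d), hg'⟩ u h4.symm]
    rcases hF.eq_or_eq_s2 (u := ⟨(v, w, c), hg⟩) (t := ⟨(v, w, d), hg'⟩) rfl rfl with h | h
    · rw [h]
    · rw [h, FlagSystem.comp_s2]

theorem exists_flag_of_mem_vertices {v : V} (hv : v ∈ vertices F) : ∃ t : Flag F, t.1.1 = v := by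
  obtain ⟨f, hf, hvf⟩ := Finset.mem_sup.1 hv
  rw [id] at hvf
  obtain ⟨w, hw⟩ : (f.erase v).Nonempty := by
    rw [← Finset.card_pos, Finset.card_erase_of_mem hvf, hF.2.1 f hf]
    norm_num
  obtain ⟨hwv, hwf⟩ := Finset.mem_erase.1 hw
  obtain ⟨z, rfl⟩ := exists_eq_insert_of_card_eq_three hwv.symm (hF.2.1 _ hf)
    (Finset.insert_subset hvf (Finset.singleton_subset_iff.2 hwf))
  exact ⟨⟨(v, w, z), hf⟩, rfl⟩

theorem exists_flag_of_mem_edges {v w : V} (hvw : v ≠ w) (he : ({v, w} : Finset V) ∈ edges F) :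
    ∃ t : Flag F, t.1.1 = v ∧ t.1.2.1 = w := by
  obtain ⟨f, hf, hs, -⟩ := mem_edges.1 he
  obtain ⟨z, rfl⟩ := exists_eq_insert_of_card_eq_three hvw (hF.2.1 _ hf) hs
  exact ⟨⟨(v, w, z), hf⟩, rfl, rfl⟩

end IsClosedSurface

instance : Finite (Flag F) :=
  Finite.of_injective (β := vertices F × vertices F × vertices F)
    (fun t => (⟨t.1.1, (mem_vertices_of_flag t).1⟩,
      ⟨t.1.2.1, (mem_vertices_of_flag t).2.1⟩,
      ⟨t.1.2.2, (mem_vertices_of_flag t).2.2⟩)) <| by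
    intro t u h
    simp only [Prod.mk.injEq, Subtype.mk.injEq] at h
    exact Subtype.ext (Prod.ext h.1 (Prod.ext h.2.1 h.2.2))

theorem card_quot_eq {X B : Type*} {r : X → X → Prop} (f : X → B) (T : Finset B)
    (hT : ∀ b, b ∈ T ↔ ∃ x, f x = b) (h : ∀ x y, Quot.mk r x = Quot.mk r y ↔ f x = f y) :
    Nat.card (Quot r) = T.card := by
  have hbij : Function.Bijective (Quot.lift (fun x => (⟨f x, (hT _).2 ⟨x, rfl⟩⟩ : T))
      fun x y hxy => Subtype.ext ((h x y).1 (Quot.sound hxy)) : Quot r → T) := by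
    constructor
    · rintro ⟨x⟩ ⟨y⟩ hxy
      exact (h x y).2 (congrArg Subtype.val hxy)
    · rintro ⟨b, hb⟩
      obtain ⟨x, rfl⟩ := (hT b).1 hb
      exact ⟨Quot.mk _ x, rfl⟩
  rw [Nat.card_eq_of_bijective _ hbij, Nat.card_eq_fintype_card, Fintype.card_coe]

namespace IsClosedSurface

variable (hF : IsClosedSurface F)
include hF

theorem card_flagSystem_vert : Nat.card hF.flagSystem.Vert = (vertices F).card :=
  card_quot_eq (fun t : Flag F => t.1.1) _
    (fun _ => ⟨fun hv => hF.exists_flag_of_mem_vertices hv, by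
      rintro ⟨t, rfl⟩
      exact (mem_vertices_of_flag t).1⟩)
    fun _ _ => hF.flagSystem_vert_eq_iff

theorem card_flagSystem_edge : Nat.card hF.flagSystem.Edge = (edges F).card :=
  card_quot_eq (fun t : Flag F => ({t.1.1, t.1.2.1} : Finset V)) _
    (fun e => ⟨fun he => by
      obtain ⟨-, -, -, h2⟩ := mem_edges.1 he
      obtain ⟨v, w, hvw, rfl⟩ := Finset.card_eq_two.1 h2
      obtain ⟨t, rfl, rfl⟩ := hF.exists_flag_of_mem_edges hvw he
      exact ⟨t, rfl⟩, by
      rintro ⟨t, rfl⟩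
      exact pair_mem_edges (hF.flag_ne t).1 t.2⟩)
    fun _ _ => hF.flagSystem_edge_eq_iff

theorem card_flagSystem_face : Nat.card hF.flagSystem.Face = F.card :=
  card_quot_eq (fun t : Flag F => ({t.1.1, t.1.2.1, t.1.2.2} : Finset V)) _
    (fun f => ⟨fun hf => by
      obtain ⟨x, y, z, -, -, -, rfl⟩ := Finset.card_eq_three.1 (hF.2.1 f hf)
      exact ⟨⟨(x, y, z), hf⟩, rfl⟩, by
      rintro ⟨t, rfl⟩
      exact t.2⟩)
    fun _ _ => hF.flagSystem_face_eq_iff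

theorem three_mul_card_eq_two_mul_card_edges : 3 * F.card = 2 * (edges F).card := by
  have h := Finset.sum_card_bipartiteAbove_eq_sum_card_bipartiteBelow
    (s := F) (t := edges F) fun f e => e ⊆ f
  have h1 : ∀ f ∈ F, (Finset.bipartiteAbove (fun f e => e ⊆ f) (edges F) f).card = 3 := by
    intro f hf
    have : Finset.bipartiteAbove (fun f e => e ⊆ f) (edges F) f = f.powersetCard 2 := by
      ext e
      simp only [Finset.mem_bipartiteAbove, Finset.mem_powersetCard, mem_edges]
      exact ⟨fun ⟨⟨_, _, _, h⟩, h'⟩ => ⟨h', h⟩, fun ⟨h, h'⟩ => ⟨⟨f, hf, h, h'⟩, h⟩⟩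
    rw [this, Finset.card_powersetCard, hF.2.1 f hf]
    rfl
  rw [Finset.sum_congr rfl h1] at h
  replace h := h.trans (Finset.sum_congr rfl hF.2.2.1)
  simpa [mul_comm] using h

theorem card_flag : Nat.card (Flag F) = 6 * F.card := by
  have := Fintype.ofFinite (Flag F)
  have := Fintype.ofFinite hF.flagSystem.Edge
  have h := hF.flagSystem.card_eq_four_mul_card_edge
  rw [← Nat.card_eq_fintype_card, ← Nat.card_eq_fintype_card, hF.card_flagSystem_edge] at h
  have := hF.three_mul_card_eq_two_mul_card_edges
  omega

theorem ncard_flags_at (v : V) : {t : Flag F | t.1.1 = v}.ncard = 2 * degree F v := by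
  classical
  have := Fintype.ofFinite (Flag F)
  rw [Set.ncard_eq_toFinset_card', Set.toFinset_ofPred,
    Finset.card_eq_sum_card_fiberwise (f := fun t : Flag F => ({t.1.1, t.1.2.1} : Finset V))
      (t := (edges F).filter fun e => v ∈ e), Finset.sum_congr rfl (g := fun _ => 2)]
  · simp [degree, mul_comm]
  · intro e he
    obtain ⟨he, hv⟩ := Finset.mem_filter.1 he
    obtain ⟨-, -, -, h2⟩ := mem_edges.1 he
    obtain ⟨w, hvw, rfl⟩ : ∃ w, v ≠ w ∧ e = {v, w} := by
      obtain ⟨x, y, hxy, rfl⟩ := Finset.card_eq_two.1 h2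
      rcases Finset.mem_insert.1 hv with rfl | hv
      · exact ⟨y, hxy, rfl⟩
      · rw [Finset.mem_singleton.1 hv]
        exact ⟨x, hxy.symm, Finset.pair_comm _ _⟩
    obtain ⟨u, rfl, rfl⟩ := hF.exists_flag_of_mem_edges hvw he
    rw [← Finset.card_pair (hF.flagSystem.ne2 u)]
    congr 1
    ext t
    simp only [Finset.mem_filter, Finset.mem_univ, true_and, Finset.mem_insert,
      Finset.mem_singleton]
    constructor
    · rintro ⟨h1, h2⟩
      have h3 : t.1.2.1 ∈ ({u.1.1, u.1.2.1} : Finset V) := by rw [← h2]; simp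
      rw [← h1, Finset.mem_insert, Finset.mem_singleton] at h3
      exact (hF.eq_or_eq_s2 h1 (h3.resolve_left (hF.flag_ne t).1.symm)).symm
    · rintro (rfl | rfl) <;> exact ⟨rfl, rfl⟩
  · intro t ht
    have ht : t.1.1 = v := by simpa using ht
    simp only [Finset.coe_filter, Set.mem_ofPred_eq, ← ht]
    exact ⟨pair_mem_edges (hF.flag_ne t).1 t.2, by simp⟩

theorem flagSystem_deg (t : Flag F) : hF.flagSystem.deg t = degree F t.1.1 := by
  have h := hF.flagSystem.ncard_vert_eq t
  simp only [hF.flagSystem_vert_eq_iff, hF.ncard_flags_at] at h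
  omega

end IsClosedSurface

end Triangulation

end Fisk

open Fisk in
/-- If a triangulation of the 2-sphere has exactly two vertices whose degrees
are not divisible by `k`, then these vertices are not adjacent. -/
theorem two_nondivisible_vertices_not_adjacent {V : Type*} [DecidableEq V]
    (k : ℕ) (hk : 0 < k)
    (F : Finset (Finset V)) (hF : IsSphere F) (a b : V)
    (ha : a ∈ vertices F) (hb : b ∈ vertices F) (hab : a ≠ b)
    (hoa : ¬ k ∣ degree F a) (hob : ¬ k ∣ degree F b)
    (honly : ∀ v ∈ vertices F, ¬ k ∣ degree F v → v = a ∨ v = b) :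
    ¬ IsAdjacent F a b := by
  rintro ⟨-, he⟩
  obtain ⟨hS, hconn, heuler⟩ := hF
  obtain ⟨t, rfl, rfl⟩ := hS.exists_flag_of_mem_edges hab he
  refine hoa ?_
  rw [← hS.flagSystem_deg t]
  refine hS.flagSystem.dvd_deg hk (fun _ => rfl) (hS.flagSystem_comp_eq hconn) ?_ ?_ t ?_ ?_
  · rw [hS.card_flag, hS.card_flagSystem_face]
  · rw [hS.card_flagSystem_vert, hS.card_flagSystem_edge, hS.card_flagSystem_face]
    unfold eulerChar at heuler
    omega
  · exact fun h => hab (hS.flagSystem_vert_eq_iff.1 h)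
  · intro u h1 h2
    rw [hS.flagSystem_deg]
    by_contra h
    rcases honly _ (mem_vertices_of_flag u).1 h with h | h
    · exact h1 (hS.flagSystem_vert_eq_iff.2 h)
    · exact h2 (hS.flagSystem_vert_eq_iff.2 h)
end

section
/- There exists a triangulation of an n-gon with no vertices on the boundary sides (only the n corners and possibly interior vertices) in which every vertex, interior and boundary alike, has even degree, if and only if n is divisible by 3. -/
namespace Fisk

section IncidenceRank

variable {α β γ : Type*}

/-- The incidence matrix over `ZMod 2` of a relation between two finsets. -/
def incidence (S : Finset α) (T : Finset β) (r : α → β → Prop) [∀ a b, Decidable (r a b)] :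
    Matrix S T (ZMod 2) :=
  Matrix.of fun a b => if r a b then 1 else 0

theorem incidence_mulVec (S : Finset α) (T : Finset β) (r : α → β → Prop)
    [∀ a b, Decidable (r a b)] (c : β → ZMod 2)
    (a : S) : (incidence S T r).mulVec (fun b => c b) a = ∑ b ∈ T with r a b, c b := by
  simp only [incidence, Matrix.mulVec, dotProduct, Matrix.of_apply, ite_mul, one_mul, zero_mul]
  rw [Finset.sum_filter, ← Finset.sum_coe_sort T]

theorem exists_extension (T : Finset β) (c : T → ZMod 2) :
    ∃ c' : β → ZMod 2, (fun b : T => c' b) = c := by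
  classical
  refine ⟨fun b => if h : b ∈ T then c ⟨b, h⟩ else 0, ?_⟩
  ext b
  simp

theorem card_le_rank_incidence_add_one (S : Finset α) (T : Finset β) (r : α → β → Prop)
    [∀ a b, Decidable (r a b)]
    (h : ∀ c : β → ZMod 2, (∀ a ∈ S, ∑ b ∈ T with r a b, c b = 0) →
      ∀ b ∈ T, ∀ b' ∈ T, c b = c b') :
    T.card ≤ (incidence S T r).rank + 1 := by
  have hker : (LinearMap.ker (incidence S T r).mulVecLin) ≤
      Submodule.span (ZMod 2) {fun _ => (1 : ZMod 2)} := by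
    intro c hc
    obtain ⟨c, rfl⟩ := exists_extension T c
    rw [LinearMap.mem_ker, Matrix.mulVecLin_apply] at hc
    have hconst := h c fun a ha => by
      rw [← incidence_mulVec S T r c ⟨a, ha⟩, hc]; rfl
    rw [Submodule.mem_span_singleton]
    rcases T.eq_empty_or_nonempty with rfl | ⟨b, hb⟩
    · exact ⟨0, funext fun b => absurd b.2 (Finset.notMem_empty _)⟩
    · exact ⟨c b, funext fun b' => by simp [hconst b hb b' b'.2]⟩
  have h1 := (Submodule.finrank_mono hker).trans (finrank_span_le_card _)
  rw [Set.toFinset_singleton, Finset.card_singleton] at h1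
  have h2 := (incidence S T r).mulVecLin.finrank_range_add_finrank_ker
  rw [Module.finrank_fintype_fun_eq_card, Fintype.card_coe] at h2
  rw [Matrix.rank]
  omega

theorem card_le_rank_incidence (S : Finset α) (T : Finset β) (r : α → β → Prop)
    [∀ a b, Decidable (r a b)]
    (h : ∀ c : β → ZMod 2, (∀ a ∈ S, ∑ b ∈ T with r a b, c b = 0) → ∀ b ∈ T, c b = 0) :
    T.card ≤ (incidence S T r).rank := by
  have hker : (LinearMap.ker (incidence S T r).mulVecLin) = ⊥ := by
    refine (Submodule.eq_bot_iff _).2 fun c hc => ?_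
    obtain ⟨c, rfl⟩ := exists_extension T c
    rw [LinearMap.mem_ker, Matrix.mulVecLin_apply] at hc
    have hz := h c fun a ha => by
      rw [← incidence_mulVec S T r c ⟨a, ha⟩, hc]; rfl
    exact funext fun b => hz b b.2
  have h2 := (incidence S T r).mulVecLin.finrank_range_add_finrank_ker
  rw [Module.finrank_fintype_fun_eq_card, Fintype.card_coe, hker, finrank_bot] at h2
  rw [Matrix.rank]
  omega

/-- Exactness in the middle of a complex `ZMod 2 ^ T → ZMod 2 ^ S → ZMod 2 ^ R` given by
incidence relations, deduced from a dimension count. -/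
theorem exists_boundary_eq (R : Finset α) (S : Finset β) (T : Finset γ)
    (r : α → β → Prop) (s : β → γ → Prop)
    [∀ a b, Decidable (r a b)] [∀ b c, Decidable (s b c)]
    (hr : ∀ x : α → ZMod 2, (∀ b ∈ S, ∑ a ∈ R with r a b, x a = 0) →
      ∀ a ∈ R, ∀ a' ∈ R, x a = x a')
    (hs : ∀ c : γ → ZMod 2, (∀ b ∈ S, ∑ t ∈ T with s b t, c t = 0) → ∀ t ∈ T, c t = 0)
    (hcomp : ∀ a ∈ R, ∀ t ∈ T, Even (S.filter fun b => r a b ∧ s b t).card)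
    (hcard : R.card + T.card = S.card + 1)
    (y : β → ZMod 2) (hy : ∀ a ∈ R, ∑ b ∈ S with r a b, y b = 0) :
    ∃ c : γ → ZMod 2, ∀ b ∈ S, ∑ t ∈ T with s b t, c t = y b := by
  have hrankM : R.card ≤ (incidence R S r).rank + 1 := by
    have := card_le_rank_incidence_add_one S R (fun b a => r a b) hr
    rwa [show incidence S R (fun b a => r a b) = (incidence R S r).transpose from rfl,
      Matrix.rank_transpose] at this
  have hrankN := card_le_rank_incidence S T s hs
  have hMN : incidence R S r * incidence S T s = 0 := by
    ext a t
    have h := (ZMod.natCast_eq_zero_iff_even).2 (hcomp a a.2 t t.2)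
    simp only [Matrix.mul_apply, incidence, Matrix.of_apply, Matrix.zero_apply]
    rw [Finset.card_filter, Nat.cast_sum, ← Finset.sum_coe_sort S] at h
    refine (Finset.sum_congr rfl fun b _ => ?_).trans h
    by_cases h1 : r a b <;> by_cases h2 : s b t <;> simp [h1, h2]
  have hle : LinearMap.range (incidence S T s).mulVecLin ≤
      LinearMap.ker (incidence R S r).mulVecLin := by
    rw [LinearMap.range_le_ker_iff, ← Matrix.mulVecLin_mul, hMN, Matrix.mulVecLin_zero]
  have hdim := (incidence R S r).mulVecLin.finrank_range_add_finrank_ker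
  rw [Module.finrank_fintype_fun_eq_card, Fintype.card_coe] at hdim
  have heq := Submodule.eq_of_le_of_finrank_le hle (by
    rw [Matrix.rank] at hrankM hrankN
    omega)
  have hmem : (fun b : S => y b) ∈ LinearMap.ker (incidence R S r).mulVecLin := by
    rw [LinearMap.mem_ker, Matrix.mulVecLin_apply]
    ext a
    rw [incidence_mulVec, hy a a.2]; rfl
  rw [← heq] at hmem
  obtain ⟨c, hc⟩ := hmem
  obtain ⟨c, rfl⟩ := exists_extension T c
  refine ⟨c, fun b hb => ?_⟩
  rw [Matrix.mulVecLin_apply] at hc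
  rw [← incidence_mulVec S T s c ⟨b, hb⟩, hc]

end IncidenceRank

section Counting

variable {V : Type*} [DecidableEq V] {F : Finset (Finset V)}

theorem mem_vertices {v : V} : v ∈ vertices F ↔ ∃ f ∈ F, v ∈ f := by
  simp [vertices, Finset.mem_sup]

theorem mem_boundaryVertices {v : V} :
    v ∈ boundaryVertices F ↔ ∃ e ∈ boundaryEdges F, v ∈ e := by
  simp [boundaryVertices, Finset.mem_sup]

theorem filter_edges_subset {f : Finset V} (hf : f ∈ F) :
    (edges F).filter (· ⊆ f) = f.powersetCard 2 := by
  ext e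
  simp only [Finset.mem_filter, mem_edges, Finset.mem_powersetCard]
  exact ⟨fun ⟨⟨_, _, _, h⟩, h'⟩ => ⟨h', h⟩, fun ⟨h, h'⟩ => ⟨⟨f, hf, h, h'⟩, h⟩⟩

theorem filter_mem_boundaryEdges : (edges F).filter (· ∈ boundaryEdges F) = boundaryEdges F := by
  rw [Finset.filter_mem_eq_inter]
  exact Finset.inter_eq_right.2 (Finset.filter_subset _ _)

theorem card_filter_mem_powersetCard_two {f : Finset V} (hf : f.card = 3) {v : V} (hv : v ∈ f) :
    ((f.powersetCard 2).filter (v ∈ ·)).card = 2 := by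
  have : (f.powersetCard 2).filter (v ∈ ·) = (f.erase v).image fun w => {v, w} := by
    ext e
    simp only [Finset.mem_filter, Finset.mem_powersetCard, Finset.mem_image, Finset.mem_erase]
    constructor
    · rintro ⟨⟨hef, he⟩, hve⟩
      obtain ⟨w, hw⟩ := Finset.card_eq_one.1 (by
        rw [Finset.card_erase_of_mem hve, he] : (e.erase v).card = 1)
      have hwe : w ∈ e.erase v := by simp [hw]
      refine ⟨w, ⟨(Finset.mem_erase.1 hwe).1, hef (Finset.mem_of_mem_erase hwe)⟩, ?_⟩
      rw [← hw, Finset.insert_erase hve]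
    · rintro ⟨w, ⟨hwv, hwf⟩, rfl⟩
      exact ⟨⟨by simp [Finset.insert_subset_iff, hv, hwf], Finset.card_pair hwv.symm⟩, by simp⟩
  rw [this, Finset.card_image_of_injOn, Finset.card_erase_of_mem hv, hf]
  intro a ha b hb hab
  simp only [Finset.coe_erase, Set.mem_sdiff, Set.mem_singleton_iff] at ha hb
  have : a ∈ ({v, b} : Finset V) := by rw [← show ({v, a} : Finset V) = {v, b} from hab]; simp
  simpa [ha.2] using this

namespace IsSurfaceWithBoundary

theorem filter_eq_pair (hF : IsSurfaceWithBoundary F) {x y : Finset V} (hx : x ∈ F)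
    (hy : y ∈ F) (hxy : (x ∩ y).card = 2) :
    x ≠ y ∧ x ∩ y ∈ edges F ∧ F.filter (x ∩ y ⊆ ·) = {x, y} := by
  have hne : x ≠ y := by
    rintro rfl
    rw [Finset.inter_self, hF.2.1 x hx] at hxy
    omega
  have he : x ∩ y ∈ edges F := mem_edges.2 ⟨x, hx, Finset.inter_subset_left, hxy⟩
  refine ⟨hne, he, (Finset.eq_of_subset_of_card_le ?_ ?_).symm⟩
  · simp [Finset.insert_subset_iff, hx, hy]
  · rw [Finset.card_pair hne]
    rcases hF.2.2.1 _ he with h | h <;> omega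

theorem sum_card_filter_subset_add_card_boundary (hF : IsSurfaceWithBoundary F)
    (E : Finset (Finset V)) (hE : E ⊆ edges F) :
    ∑ e ∈ E, (F.filter (e ⊆ ·)).card + (E.filter (· ∈ boundaryEdges F)).card = 2 * E.card := by
  rw [Finset.card_filter, ← Finset.sum_add_distrib, mul_comm, ← smul_eq_mul, ← Finset.sum_const]
  refine Finset.sum_congr rfl fun e he => ?_
  simp only [boundaryEdges, Finset.mem_filter, hE he, true_and]
  rcases hF.2.2.1 e (hE he) with h | h <;> simp [h]

theorem three_mul_card_add_card_boundaryEdges (hF : IsSurfaceWithBoundary F) :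
    3 * F.card + (boundaryEdges F).card = 2 * (edges F).card := by
  have h := hF.sum_card_filter_subset_add_card_boundary (edges F) subset_rfl
  have h2 := Finset.sum_card_bipartiteAbove_eq_sum_card_bipartiteBelow
    (s := edges F) (t := F) (fun e f => e ⊆ f)
  simp only [Finset.bipartiteAbove, Finset.bipartiteBelow] at h2
  rw [h2, Finset.sum_congr rfl (fun f hf => by
    rw [filter_edges_subset hf, Finset.card_powersetCard, hF.2.1 f hf])] at h
  rw [filter_mem_boundaryEdges] at h
  simpa [mul_comm] using h

theorem two_mul_card_faces_at_add (hF : IsSurfaceWithBoundary F) (v : V) :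
    2 * (F.filter (v ∈ ·)).card + ((boundaryEdges F).filter (v ∈ ·)).card =
      2 * ((edges F).filter (v ∈ ·)).card := by
  have h := hF.sum_card_filter_subset_add_card_boundary ((edges F).filter (v ∈ ·))
    (Finset.filter_subset _ _)
  have h2 := Finset.sum_card_bipartiteAbove_eq_sum_card_bipartiteBelow
    (s := (edges F).filter (v ∈ ·)) (t := F) (fun e f => e ⊆ f)
  simp only [Finset.bipartiteAbove, Finset.bipartiteBelow] at h2
  have h4 : ∀ f ∈ F, (((edges F).filter (v ∈ ·)).filter (· ⊆ f)).card =
      if v ∈ f then 2 else 0 := fun f hf => by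
    rw [Finset.filter_comm, filter_edges_subset hf]
    split_ifs with hv
    · exact card_filter_mem_powersetCard_two (hF.2.1 f hf) hv
    · rw [Finset.card_eq_zero, Finset.filter_eq_empty_iff]
      exact fun e he hve => hv ((Finset.mem_powersetCard.1 he).1 hve)
  rw [h2, Finset.sum_congr rfl h4, ← Finset.sum_filter, Finset.sum_const, smul_eq_mul,
    Finset.filter_comm] at h
  rw [filter_mem_boundaryEdges] at h
  linarith

theorem card_faces_at_le (hF : IsSurfaceWithBoundary F) (v : V) :
    (F.filter (v ∈ ·)).card + ((boundaryEdges F).filter (v ∈ ·)).card ≤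
      ((edges F).filter (v ∈ ·)).card + 1 := by
  have key := card_le_rank_incidence_add_one
    (((edges F).filter (v ∈ ·)).filter (· ∉ boundaryEdges F)) (F.filter (v ∈ ·))
    (fun e f => e ⊆ f) (fun c hc f hf g hg => by
      rw [Finset.mem_filter] at hf hg
      refine Relation.ReflTransGen.head_induction_on (hF.2.2.2 v f hf.1 g hg.1 hf.2 hg.2) rfl ?_
      rintro x y ⟨hx, hy, hvx, hvy, hxy⟩ - ih
      obtain ⟨hne, he, hpair⟩ := hF.filter_eq_pair hx hy hxy
      have := hc (x ∩ y) (by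
        simp [he, hvx, hvy, boundaryEdges, hpair, Finset.card_pair hne])
      have hfil : (F.filter (v ∈ ·)).filter (x ∩ y ⊆ ·) = {x, y} := by
        rw [Finset.filter_comm, hpair]
        ext z
        simp only [Finset.mem_filter, Finset.mem_insert, Finset.mem_singleton]
        constructor
        · exact And.left
        · rintro (rfl | rfl) <;> simp [hvx, hvy]
      rw [hfil, Finset.sum_pair hne, CharTwo.add_eq_zero] at this
      exact this.trans ih)
  have hrank := Matrix.rank_le_card_height (incidence
    (((edges F).filter (v ∈ ·)).filter (· ∉ boundaryEdges F)) (F.filter (v ∈ ·))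
    (fun e f => e ⊆ f))
  rw [Fintype.card_coe] at hrank
  have hsplit := Finset.card_filter_add_card_filter_not (s := (edges F).filter (v ∈ ·))
    (· ∈ boundaryEdges F)
  rw [Finset.filter_comm, filter_mem_boundaryEdges] at hsplit
  omega

theorem card_boundaryEdges_at (hF : IsSurfaceWithBoundary F) {v : V}
    (hv : v ∈ boundaryVertices F) :
    ((boundaryEdges F).filter (v ∈ ·)).card = 2 := by
  obtain ⟨e, he, hve⟩ := mem_boundaryVertices.1 hv
  have hpos : 0 < ((boundaryEdges F).filter (v ∈ ·)).card :=
    Finset.card_pos.2 ⟨e, Finset.mem_filter.2 ⟨he, hve⟩⟩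
  have h1 := hF.two_mul_card_faces_at_add v
  have h2 := hF.card_faces_at_le v
  omega

theorem card_boundaryVertices (hF : IsSurfaceWithBoundary F) :
    (boundaryVertices F).card = (boundaryEdges F).card := by
  have h := Finset.sum_card_bipartiteAbove_eq_sum_card_bipartiteBelow
    (s := boundaryVertices F) (t := boundaryEdges F) (fun v e => v ∈ e)
  simp only [Finset.bipartiteAbove, Finset.bipartiteBelow] at h
  have h2 : ∀ e ∈ boundaryEdges F, ((boundaryVertices F).filter (· ∈ e)).card = 2 :=
    fun e he => by
      have : (boundaryVertices F).filter (· ∈ e) = e := by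
        ext v
        simp only [Finset.mem_filter, mem_boundaryVertices, and_iff_right_iff_imp]
        exact fun hv => ⟨e, he, hv⟩
      obtain ⟨_, _, _, hcard⟩ := mem_edges.1 (Finset.mem_of_mem_filter e he)
      rw [this, hcard]
  rw [Finset.sum_congr rfl (fun v hv => hF.card_boundaryEdges_at hv),
    Finset.sum_congr rfl h2] at h
  simpa using h

end IsSurfaceWithBoundary

theorem IsDisk.exists_sum_faces_eq_one (hF : IsDisk F)
    (heven : ∀ v ∈ vertices F, Even (degree F v)) :
    ∃ c : Finset V → ZMod 2, ∀ e ∈ edges F, ∑ f ∈ F with e ⊆ f, c f = 1 := by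
  obtain ⟨hS, hconn, hχ, e₀, he₀⟩ := hF
  refine exists_boundary_eq (vertices F) (edges F) F (fun v e => v ∈ e)
    (fun e f => e ⊆ f) ?_ ?_ ?_ ?_ (fun _ => 1) ?_
  · intro x hx u hu w hw
    have hface : ∀ f ∈ F, ∀ a ∈ f, ∀ b ∈ f, x a = x b := by
      intro f hf a ha b hb
      by_cases hab : a = b
      · rw [hab]
      · have := hx {a, b} (mem_edges.2
          ⟨f, hf, by simp [Finset.insert_subset_iff, ha, hb], Finset.card_pair hab⟩)
        have hfil : (vertices F).filter (· ∈ ({a, b} : Finset V)) = {a, b} := by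
          ext z
          simp only [Finset.mem_filter, and_iff_right_iff_imp, mem_vertices]
          intro hz
          rcases Finset.mem_insert.1 hz with rfl | hz
          · exact ⟨f, hf, ha⟩
          · rw [Finset.mem_singleton.1 hz]; exact ⟨f, hf, hb⟩
        rwa [hfil, Finset.sum_pair hab, CharTwo.add_eq_zero] at this
    obtain ⟨f, hf, huf⟩ := mem_vertices.1 hu
    obtain ⟨g, hg, hwg⟩ := mem_vertices.1 hw
    revert u
    refine Relation.ReflTransGen.head_induction_on (hconn f hf g hg) ?_ ?_
    · exact fun u _ hug => hface g hg u hug w hwg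
    · rintro y z ⟨hy, hz, hyz⟩ - ih u hu huy
      obtain ⟨p, hp⟩ := Finset.card_pos.1 (by omega : 0 < (y ∩ z).card)
      rw [Finset.mem_inter] at hp
      exact (hface y hy u huy p hp.1).trans (ih p (mem_vertices.2 ⟨z, hz, hp.2⟩) hp.2)
  · intro x hx f hf
    obtain ⟨he₀E, hcard⟩ := Finset.mem_filter.1 he₀
    obtain ⟨g, hg⟩ := Finset.card_eq_one.1 hcard
    have hgF : g ∈ F := Finset.mem_of_mem_filter g (by rw [hg]; simp : g ∈ F.filter (e₀ ⊆ ·))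
    have hg0 : x g = 0 := by
      have := hx e₀ he₀E
      rwa [hg, Finset.sum_singleton] at this
    refine Relation.ReflTransGen.head_induction_on (hconn f hf g hgF) hg0 ?_
    rintro y z ⟨hy, hz, hyz⟩ - ih
    obtain ⟨hne, he, hpair⟩ := hS.filter_eq_pair hy hz hyz
    have := hx _ he
    rw [hpair, Finset.sum_pair hne, CharTwo.add_eq_zero] at this
    exact this.trans ih
  · intro v _ f hf
    rw [← Finset.filter_filter, Finset.filter_comm, filter_edges_subset hf]
    by_cases hv : v ∈ f
    · rw [card_filter_mem_powersetCard_two (hS.2.1 f hf) hv]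
      exact even_two
    · rw [Finset.filter_false_of_mem fun e he hve => hv ((Finset.mem_powersetCard.1 he).1 hve)]
      simp
  · unfold eulerChar at hχ
    omega
  · intro v hv
    rw [Finset.sum_const, nsmul_eq_mul, mul_one]
    exact (ZMod.natCast_eq_zero_iff_even).2 (heven v hv)

/-- The faces of an even disk can be coloured so that every edge lies in exactly one black face. -/
theorem IsDisk.exists_black_faces (hF : IsDisk F)
    (heven : ∀ v ∈ vertices F, Even (degree F v)) :
    ∃ B ⊆ F, ∀ e ∈ edges F, (B.filter (e ⊆ ·)).card = 1 := by
  obtain ⟨c, hc⟩ := hF.exists_sum_faces_eq_one heven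
  refine ⟨F.filter (c · = 1), Finset.filter_subset _ _, fun e he => ?_⟩
  have hsum := hc e he
  have hle : ((F.filter (c · = 1)).filter (e ⊆ ·)).card ≤ 2 := by
    rw [Finset.filter_comm]
    refine (Finset.card_filter_le _ _).trans ?_
    rcases hF.1.2.2.1 e he with h | h <;> omega
  have hcast : (((F.filter (c · = 1)).filter (e ⊆ ·)).card : ZMod 2) = 1 := by
    rw [Finset.filter_comm, Finset.card_filter, Nat.cast_sum]
    refine (Finset.sum_congr rfl fun f _ => ?_).trans hsum
    simp only [Nat.cast_ite, Nat.cast_one, Nat.cast_zero]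
    generalize c f = z
    revert z
    decide
  obtain ⟨k, hk⟩ := (ZMod.natCast_eq_one_iff_odd).1 hcast
  omega

theorem IsDisk.three_dvd_card_boundaryVertices (hF : IsDisk F)
    (heven : ∀ v ∈ vertices F, Even (degree F v)) : 3 ∣ (boundaryVertices F).card := by
  obtain ⟨B, hB, hblack⟩ := hF.exists_black_faces heven
  have h := Finset.sum_card_bipartiteAbove_eq_sum_card_bipartiteBelow
    (s := edges F) (t := B) (fun e f => e ⊆ f)
  simp only [Finset.bipartiteAbove, Finset.bipartiteBelow] at h
  have hthree : ∀ f ∈ B, ((edges F).filter (· ⊆ f)).card = 3 := fun f hf => by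
    have hf := hB hf
    rw [filter_edges_subset hf, Finset.card_powersetCard, hF.1.2.1 f hf]
    rfl
  rw [Finset.sum_congr rfl hblack, Finset.sum_congr rfl hthree] at h
  simp only [Finset.sum_const, smul_eq_mul, mul_one] at h
  have h3 := hF.1.three_mul_card_add_card_boundaryEdges
  rw [hF.1.card_boundaryVertices]
  omega

end Counting

section Gluing

variable {V : Type*} [DecidableEq V] {F : Finset (Finset V)} {a b x : V}

theorem notMem_edge_of_notMem_vertices (hx : x ∉ vertices F) {e : Finset V} (he : e ∈ edges F) :
    x ∉ e := by
  obtain ⟨f, hf, hef, -⟩ := mem_edges.1 he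
  exact fun hxe => hx (mem_vertices.2 ⟨f, hf, hef hxe⟩)

theorem edge_subset_vertices {e : Finset V} (he : e ∈ edges F) : e ⊆ vertices F := by
  obtain ⟨f, hf, hef, -⟩ := mem_edges.1 he
  exact fun v hv => mem_vertices.2 ⟨f, hf, hef hv⟩

theorem vertices_insert_triangle (hab : {a, b} ∈ edges F) :
    vertices (insert {a, b, x} F) = insert x (vertices F) := by
  have := edge_subset_vertices hab
  simp only [Finset.insert_subset_iff, Finset.singleton_subset_iff] at this
  have h : vertices (insert {a, b, x} F) = {a, b, x} ∪ vertices F := by simp [vertices]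
  rw [h]
  grind

theorem edges_insert_triangle (hab : {a, b} ∈ edges F) (hx : x ∉ vertices F) :
    edges (insert {a, b, x} F) = insert {a, x} (insert {b, x} (edges F)) := by
  have hx' := notMem_edge_of_notMem_vertices hx hab
  have hcard : ({a, b} : Finset V).card = 2 := (mem_edges.1 hab).choose_spec.2.2
  have hne : a ≠ b := by rintro rfl; simp at hcard
  have hsub : ({a, b, x} : Finset V).powersetCard 2 = {{a, b}, {a, x}, {b, x}} := by
    ext e
    simp only [Finset.mem_powersetCard, Finset.mem_insert, Finset.mem_singleton]
    constructor
    · rintro ⟨he, hc⟩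
      obtain ⟨u, w, huw, rfl⟩ := Finset.card_eq_two.1 hc
      have hu := he (Finset.mem_insert_self u _)
      have hw := he (Finset.mem_insert_of_mem (Finset.mem_singleton_self w))
      grind
    · grind
  have h : edges (insert {a, b, x} F) = ({a, b, x} : Finset V).powersetCard 2 ∪ edges F := by
    simp [edges]
  rw [h, hsub]
  grind

theorem triangle_notMem (hx : x ∉ vertices F) : {a, b, x} ∉ F :=
  fun h => hx (mem_vertices.2 ⟨_, h, by simp⟩)

theorem faces_at_insert_triangle (hab : {a, b} ∈ edges F) (hx : x ∉ vertices F) {e : Finset V}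
    (he : e ∈ edges F) : (insert {a, b, x} F).filter (e ⊆ ·) =
      if e = {a, b} then insert {a, b, x} (F.filter (e ⊆ ·)) else F.filter (e ⊆ ·) := by
  have hxe := notMem_edge_of_notMem_vertices hx he
  have h2 : e.card = 2 := (mem_edges.1 he).choose_spec.2.2
  have hab2 : ({a, b} : Finset V).card = 2 := (mem_edges.1 hab).choose_spec.2.2
  have hiff : e ⊆ {a, b, x} ↔ e = {a, b} := by
    refine ⟨fun h => Finset.eq_of_subset_of_card_le (fun v hv => ?_) (by omega), ?_⟩
    · have := h hv
      grind
    · rintro rfl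
      grind
  rw [Finset.filter_insert]
  simp only [hiff]

theorem faces_at_new_edge (hx : x ∉ vertices F) {e : Finset V} (hxe : x ∈ e)
    (he : e ⊆ {a, b, x}) : (insert {a, b, x} F).filter (e ⊆ ·) = {{a, b, x}} := by
  rw [Finset.filter_insert, if_pos he, Finset.filter_eq_empty_iff.2]
  · rfl
  · exact fun f hf hef => hx (mem_vertices.2 ⟨f, hf, hef hxe⟩)

theorem boundaryEdges_insert_triangle (hab : {a, b} ∈ boundaryEdges F) (hx : x ∉ vertices F) :
    boundaryEdges (insert {a, b, x} F) =
      insert {a, x} (insert {b, x} ((boundaryEdges F).erase {a, b})) := by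
  obtain ⟨habE, hab1⟩ := Finset.mem_filter.1 hab
  have hax := faces_at_new_edge (a := a) (b := b) hx (e := {a, x}) (by simp) (by grind)
  have hbx := faces_at_new_edge (a := a) (b := b) hx (e := {b, x}) (by simp) (by grind)
  have hold : (edges F).filter (fun e => ((insert {a, b, x} F).filter (e ⊆ ·)).card = 1) =
      (boundaryEdges F).erase {a, b} := by
    ext e
    simp only [boundaryEdges, Finset.mem_filter, Finset.mem_erase]
    by_cases he : e ∈ edges F
    · rw [faces_at_insert_triangle habE hx he]
      by_cases h : e = {a, b}
      · subst h
        rw [if_pos rfl, Finset.card_insert_of_notMem fun h =>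
          triangle_notMem hx (Finset.mem_of_mem_filter _ h), hab1]
        simp
      · simp [h, he]
    · simp [he]
  rw [boundaryEdges, edges_insert_triangle habE hx, Finset.filter_insert,
    if_pos (by rw [hax, Finset.card_singleton]), Finset.filter_insert,
    if_pos (by rw [hbx, Finset.card_singleton]), hold]

theorem boundaryVertices_insert_triangle (hab : {a, b} ∈ boundaryEdges F)
    (hx : x ∉ vertices F) :
    boundaryVertices (insert {a, b, x} F) = insert x (boundaryVertices F) := by
  ext v
  rw [Finset.mem_insert, mem_boundaryVertices, mem_boundaryVertices,
    boundaryEdges_insert_triangle hab hx]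
  constructor
  · rintro ⟨e, he, hve⟩
    simp only [Finset.mem_insert, Finset.mem_erase] at he
    rcases he with rfl | rfl | he
    · rcases Finset.mem_insert.1 hve with rfl | hve
      · exact Or.inr ⟨_, hab, by simp⟩
      · exact Or.inl (Finset.mem_singleton.1 hve)
    · rcases Finset.mem_insert.1 hve with rfl | hve
      · exact Or.inr ⟨_, hab, by simp⟩
      · exact Or.inl (Finset.mem_singleton.1 hve)
    · exact Or.inr ⟨e, he.2, hve⟩
  · rintro (rfl | ⟨e, he, hve⟩)
    · exact ⟨{a, v}, by simp, by simp⟩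
    · by_cases h : e = {a, b}
      · subst h
        rcases Finset.mem_insert.1 hve with rfl | hve
        · exact ⟨{v, x}, by simp, by simp⟩
        · rw [Finset.mem_singleton] at hve
          subst hve
          exact ⟨{v, x}, by simp, by simp⟩
      · exact ⟨e, by simp [h, he], hve⟩

theorem card_boundaryVertices_insert_triangle (hab : {a, b} ∈ boundaryEdges F)
    (hx : x ∉ vertices F) :
    (boundaryVertices (insert {a, b, x} F)).card = (boundaryVertices F).card + 1 := by
  rw [boundaryVertices_insert_triangle hab hx, Finset.card_insert_of_notMem]
  intro h
  obtain ⟨e, he, hxe⟩ := mem_boundaryVertices.1 h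
  exact notMem_edge_of_notMem_vertices hx (Finset.mem_of_mem_filter e he) hxe

theorem new_edges_ne (hab : {a, b} ∈ edges F) (hx : x ∉ vertices F) :
    {a, x} ∉ edges F ∧ {b, x} ∉ edges F ∧ a ≠ b ∧ a ≠ x ∧ b ≠ x ∧
      ({a, x} : Finset V) ≠ {b, x} := by
  have hx' := notMem_edge_of_notMem_vertices hx hab
  have hcard : ({a, b} : Finset V).card = 2 := (mem_edges.1 hab).choose_spec.2.2
  have hne : a ≠ b := by rintro rfl; simp at hcard
  refine ⟨fun h => notMem_edge_of_notMem_vertices hx h (by simp),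
    fun h => notMem_edge_of_notMem_vertices hx h (by simp), hne, ?_, ?_, ?_⟩
  · grind
  · grind
  · intro h
    have : a ∈ ({b, x} : Finset V) := h ▸ Finset.mem_insert_self a _
    grind

theorem degree_insert_triangle (hab : {a, b} ∈ edges F) (hx : x ∉ vertices F) (v : V) :
    degree (insert {a, b, x} F) v =
      degree F v + (if v = a then 1 else 0) + (if v = b then 1 else 0) +
        (if v = x then 2 else 0) := by
  obtain ⟨h1, h2, hne, hax, hbx, h3⟩ := new_edges_ne hab hx
  rw [degree, degree, edges_insert_triangle hab hx, Finset.card_filter, Finset.card_filter,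
    Finset.sum_insert (by simp [h1, h3]), Finset.sum_insert h2]
  simp only [Finset.mem_insert, Finset.mem_singleton]
  split_ifs <;> grind

theorem degree_eq_zero {v : V} (hv : v ∉ vertices F) : degree F v = 0 := by
  rw [degree, Finset.card_eq_zero, Finset.filter_eq_empty_iff]
  exact fun e he => notMem_edge_of_notMem_vertices hv he

theorem IsDisk.insert_triangle (hF : IsDisk F) (hab : {a, b} ∈ boundaryEdges F)
    (hx : x ∉ vertices F) : IsDisk (insert {a, b, x} F) := by
  obtain ⟨⟨hne, h3, hE, hlink⟩, hconn, hχ, hbd⟩ := hF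
  obtain ⟨habE, hab1⟩ := Finset.mem_filter.1 hab
  obtain ⟨h1, h2, hne', hax, hbx, hnew⟩ := new_edges_ne habE hx
  obtain ⟨g, hg, habg, -⟩ := mem_edges.1 habE
  have hxg : x ∉ g := fun h => hx (mem_vertices.2 ⟨g, hg, h⟩)
  have hinter : ({a, b, x} : Finset V) ∩ g = {a, b} := by
    have ha := habg (Finset.mem_insert_self a _)
    have hb := habg (Finset.mem_insert_of_mem (Finset.mem_singleton_self b))
    ext v
    simp only [Finset.mem_inter, Finset.mem_insert, Finset.mem_singleton]
    grind
  have hcard : (({a, b, x} : Finset V) ∩ g).card = 2 := by rw [hinter, Finset.card_pair hne']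
  have hcard' : (g ∩ ({a, b, x} : Finset V)).card = 2 := by rwa [Finset.inter_comm]
  have hmem : ∀ {f}, f ∈ F → f ∈ insert {a, b, x} F := fun h => Finset.mem_insert_of_mem h
  have hmem' : {a, b, x} ∈ insert {a, b, x} F := Finset.mem_insert_self _ _
  refine ⟨⟨⟨_, hmem'⟩, ?_, ?_, ?_⟩, ?_, ?_, ?_⟩
  · intro f hf
    rcases Finset.mem_insert.1 hf with rfl | hf
    · exact Finset.card_eq_three.2 ⟨a, b, x, hne', hax, hbx, rfl⟩
    · exact h3 f hf
  · intro e he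
    rw [edges_insert_triangle habE hx, Finset.mem_insert, Finset.mem_insert] at he
    rcases he with rfl | rfl | he
    · left
      rw [faces_at_new_edge hx (by simp) (by grind), Finset.card_singleton]
    · left
      rw [faces_at_new_edge hx (by simp) (by grind), Finset.card_singleton]
    · rw [faces_at_insert_triangle habE hx he]
      split_ifs with h
      · right
        rw [Finset.card_insert_of_notMem fun h =>
          triangle_notMem hx (Finset.mem_of_mem_filter _ h), h, hab1]
      · exact hE e he
  · have hold : ∀ v, ∀ f ∈ F, ∀ f' ∈ F, v ∈ f → v ∈ f' → Relation.ReflTransGen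
        (fun y z => y ∈ insert {a, b, x} F ∧ z ∈ insert {a, b, x} F ∧ v ∈ y ∧ v ∈ z ∧
          (y ∩ z).card = 2) f f' := fun v f hf f' hf' hvf hvf' =>
      Relation.ReflTransGen.mono (fun y z ⟨hy, hz, h⟩ => ⟨hmem hy, hmem hz, h⟩) _ _
        (hlink v f hf f' hf' hvf hvf')
    have hv : ∀ v ∈ ({a, b, x} : Finset V), ∀ f ∈ F, v ∈ f → v ∈ g := by
      intro v hv f hf hvf
      refine habg ?_
      have : v ≠ x := by rintro rfl; exact hx (mem_vertices.2 ⟨f, hf, hvf⟩)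
      grind
    intro v f hf f' hf' hvf hvf'
    rcases Finset.mem_insert.1 hf with rfl | hf <;> rcases Finset.mem_insert.1 hf' with rfl | hf'
    · exact Relation.ReflTransGen.refl
    · have hvg := hv v hvf f' hf' hvf'
      exact (hold v g hg f' hf' hvg hvf').head ⟨hmem', hmem hg, hvf, hvg, hcard⟩
    · have hvg := hv v hvf' f hf hvf
      exact (hold v f hf g hg hvf hvg).tail ⟨hmem hg, hmem', hvg, hvf', hcard'⟩
    · exact hold v f hf f' hf' hvf hvf'
  · have hold : ∀ f ∈ F, ∀ f' ∈ F, Relation.ReflTransGen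
        (fun y z => y ∈ insert {a, b, x} F ∧ z ∈ insert {a, b, x} F ∧ (y ∩ z).card = 2) f f' :=
      fun f hf f' hf' =>
        Relation.ReflTransGen.mono (fun y z ⟨hy, hz, h⟩ => ⟨hmem hy, hmem hz, h⟩) _ _
          (hconn f hf f' hf')
    intro f hf f' hf'
    rcases Finset.mem_insert.1 hf with rfl | hf <;> rcases Finset.mem_insert.1 hf' with rfl | hf'
    · exact Relation.ReflTransGen.refl
    · exact (hold g hg f' hf').head ⟨hmem', hmem hg, hcard⟩
    · exact (hold f hf g hg).tail ⟨hmem hg, hmem', hcard'⟩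
    · exact hold f hf f' hf'
  · unfold eulerChar at hχ ⊢
    rw [vertices_insert_triangle habE, edges_insert_triangle habE hx,
      Finset.card_insert_of_notMem hx, Finset.card_insert_of_notMem (by simp [h1, hnew]),
      Finset.card_insert_of_notMem h2, Finset.card_insert_of_notMem (triangle_notMem hx)]
    push_cast
    linarith
  · rw [boundaryEdges_insert_triangle hab hx]
    exact Finset.insert_nonempty _ _

/-- Attaching a triangle on a boundary edge and one
more triangle on each of its two new sides keeps all degrees even and adds three corners. -/
theorem IsDisk.exists_add_three_corners [Infinite V] (hF : IsDisk F)
    (heven : ∀ v, Even (degree F v)) :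
    ∃ G : Finset (Finset V), IsDisk G ∧
      (boundaryVertices G).card = (boundaryVertices F).card + 3 ∧ ∀ v, Even (degree G v) := by
  obtain ⟨e, he⟩ := hF.2.2.2
  obtain ⟨_, _, _, hcard⟩ := mem_edges.1 (Finset.mem_of_mem_filter e he)
  obtain ⟨a, b, hab, rfl⟩ := Finset.card_eq_two.1 hcard
  obtain ⟨x, hx⟩ := Infinite.exists_notMem_finset (vertices F)
  obtain ⟨-, -, -, hax, hbx, hnew⟩ := new_edges_ne (Finset.mem_of_mem_filter _ he) hx
  have hF₁ := hF.insert_triangle he hx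
  have hc₁ := card_boundaryVertices_insert_triangle he hx
  have hd₁ := degree_insert_triangle (Finset.mem_of_mem_filter _ he) hx
  have he₁ := boundaryEdges_insert_triangle he hx
  generalize insert {a, b, x} F = F₁ at hF₁ hc₁ hd₁ he₁
  have hax₁ : {a, x} ∈ boundaryEdges F₁ := by simp [he₁]
  have hbx₁ : {b, x} ∈ boundaryEdges F₁ := by simp [he₁]
  obtain ⟨y, hy⟩ := Infinite.exists_notMem_finset (vertices F₁)
  have hF₂ := hF₁.insert_triangle hax₁ hy
  have hc₂ := card_boundaryVertices_insert_triangle hax₁ hy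
  have hd₂ := degree_insert_triangle (Finset.mem_of_mem_filter _ hax₁) hy
  have he₂ := boundaryEdges_insert_triangle hax₁ hy
  generalize insert {a, x, y} F₁ = F₂ at hF₂ hc₂ hd₂ he₂
  have hbx₂ : {b, x} ∈ boundaryEdges F₂ := by simp [he₂, hbx₁, hnew.symm]
  obtain ⟨z, hz⟩ := Infinite.exists_notMem_finset (vertices F₂)
  refine ⟨insert {b, x, z} F₂, hF₂.insert_triangle hbx₂ hz, ?_, fun v => ?_⟩
  · rw [card_boundaryVertices_insert_triangle hbx₂ hz, hc₂, hc₁]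
  · rw [degree_insert_triangle (Finset.mem_of_mem_filter _ hbx₂) hz, hd₂, hd₁]
    have := heven v
    split_ifs <;> grind

theorem isDisk_singleton_triangle : IsDisk {({0, 1, 2} : Finset ℕ)} := by
  refine ⟨⟨by simp, by decide, by decide, ?_⟩, ?_, by decide, by decide⟩
  · intro v f hf g hg _ _
    rw [Finset.mem_singleton.1 hf, Finset.mem_singleton.1 hg]
  · intro f hf g hg
    rw [Finset.mem_singleton.1 hf, Finset.mem_singleton.1 hg]

theorem exists_even_disk (k : ℕ) :
    ∃ F : Finset (Finset ℕ), IsDisk F ∧ (boundaryVertices F).card = 3 * (k + 1) ∧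
      ∀ v, Even (degree F v) := by
  induction k with
  | zero =>
    refine ⟨{{0, 1, 2}}, isDisk_singleton_triangle, by decide, fun v => ?_⟩
    by_cases hv : v ∈ vertices {({0, 1, 2} : Finset ℕ)}
    · revert v
      decide
    · rw [degree_eq_zero hv]
      exact Even.zero
  | succ k ih =>
    obtain ⟨F, hF, hc, heven⟩ := ih
    obtain ⟨G, hG, hc', heven'⟩ := hF.exists_add_three_corners heven
    exact ⟨G, hG, by omega, heven'⟩

end Gluing

end Fisk


open Fisk in
/-- There is a triangulation of an `n`-gon (interior vertices allowed, no
vertices inside the boundary sides, so the boundary vertices are exactly the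
`n` corners) with all vertices of even degree if and only if `3 ∣ n`. -/
theorem even_triangulation_of_ngon_iff (n : ℕ) (hn : 3 ≤ n) :
    (∃ F : Finset (Finset ℕ),
        IsDisk F ∧ (boundaryVertices F).card = n ∧
        ∀ v ∈ vertices F, Even (degree F v)) ↔ 3 ∣ n := by
  constructor
  · rintro ⟨F, hF, rfl, heven⟩
    exact hF.three_dvd_card_boundaryVertices heven
  · rintro ⟨k, rfl⟩
    obtain ⟨F, hF, hc, heven⟩ := exists_even_disk (k - 1)
    exact ⟨F, hF, by omega, fun v _ => heven v⟩
end
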